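/- arXiv:math/0512042 — 7 statements merged into one kernel-verified Lean document; each statement's English description precedes it below -/
import Mathlib

section
/- Let F = Fₘ be the free group on m generators, H a complex Hilbert space, n ≥ 1, and φ : Sₙ → L(H) a positive definite function which is radial, i.e., φ(s) depends only on |s|. Then φ has a positive definite extension Φ : F → L(H) which is radial (Φ(s) depends only on |s|). -/
open scoped ComplexOrder

/-- A function `φ` (with relevant values on a symmetric subset `S` of the free group) is
*positive definite on `S`* if for every finite family `s₁, …, s_k ∈ S` with
`sᵢ⁻¹sⱼ ∈ S` for all `i, j`, the block operator matrix `[φ(sᵢ⁻¹sⱼ)]` is positive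
semidefinite. -/
def IsPosDefOn {m : ℕ} {H : Type*} [NormedAddCommGroup H] [InnerProductSpace ℂ H]
    (S : Set (FreeGroup (Fin m))) (φ : FreeGroup (Fin m) → H →L[ℂ] H) : Prop :=
  ∀ (k : ℕ) (s : Fin k → FreeGroup (Fin m)), (∀ i, s i ∈ S) →
    (∀ i j, (s i)⁻¹ * s j ∈ S) → ∀ h : Fin k → H,
    0 ≤ ∑ i, ∑ j, (inner ℂ (h i) (φ ((s i)⁻¹ * s j) (h j)) : ℂ)

section partA

open ContinuousLinearMap

/-- Radial positivity on families of diameter at most `N`. -/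
def RPos {X : Type} (d : X → X → ℕ) {H : Type*} [NormedAddCommGroup H] [InnerProductSpace ℂ H]
    (A : ℕ → H →L[ℂ] H) (N : ℕ) : Prop :=
  ∀ (k : ℕ) (s : Fin k → X), (∀ i j, d (s i) (s j) ≤ N) → ∀ h : Fin k → H,
    0 ≤ ∑ i, ∑ j, (inner ℂ (h i) (A (d (s i) (s j)) (h j)) : ℂ)

section abstract_part

universe u

variable {X : Type} {d : X → X → ℕ} {H : Type u} [NormedAddCommGroup H] [InnerProductSpace ℂ H]
  {A : ℕ → H →L[ℂ] H} {n : ℕ}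

theorem RPos.fintype (hA : RPos d A n) {ι : Type*} [Fintype ι] (s : ι → X)
    (hs : ∀ i j, d (s i) (s j) ≤ n) (h : ι → H) :
    0 ≤ ∑ i, ∑ j, (inner ℂ (h i) (A (d (s i) (s j)) (h j)) : ℂ) := by
  have e := (Fintype.equivFin ι).symm
  have := hA _ (fun i => s (e i)) (fun i j => hs _ _) (fun i => h (e i))
  rw [← e.sum_comp]
  simp_rw [← e.sum_comp (fun j => (inner ℂ (h _) (A (d (s _) (s j)) (h j)) : ℂ))]
  exact this

theorem RPos.symm_inner (hA : RPos d A n) (dself : ∀ x, d x x = 0) (dsymm : ∀ x y, d x y = d y x)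
    {x y : X} (hxy : d x y ≤ n) (h k : H) :
    (inner ℂ (A (d x y) h) k : ℂ) = inner ℂ h (A (d x y) k) := by
  have key : ∀ h k : H, (inner ℂ h (A (d x y) k) + inner ℂ k (A (d x y) h) : ℂ).im = 0 := by
    intro h k
    have h1 := hA.fintype (fun _ : Unit => x) (by simp [dself]) (fun _ => h)
    have h2 := hA.fintype (fun _ : Unit => x) (by simp [dself]) (fun _ => k)
    have h3 := hA.fintype (fun b : Bool => if b then x else y)
      (by simp [dself, dsymm y x, hxy]) (fun b => if b then h else k)
    simp [dself, dsymm y x] at h1 h2 h3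
    have e1 := (Complex.nonneg_iff.1 h1).2
    have e2 := (Complex.nonneg_iff.1 h2).2
    have e3 := (Complex.nonneg_iff.1 h3).2
    simp only [Complex.add_im] at *
    linarith
  have k1 := key h k
  have k2 := key h (Complex.I • k)
  rw [← inner_conj_symm]
  simp [inner_smul_left, inner_smul_right] at k1 k2
  apply Complex.ext <;> simp only [Complex.conj_re, Complex.conj_im] <;> linarith

theorem RPos.adjoint_eq [CompleteSpace H] (hA : RPos d A n) (dself : ∀ x, d x x = 0)
    (dsymm : ∀ x y, d x y = d y x)
    {x y : X} (hxy : d x y ≤ n) : adjoint (A (d x y)) = A (d x y) := by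
  symm
  rw [ContinuousLinearMap.eq_adjoint_iff]
  exact fun h k => hA.symm_inner dself dsymm hxy h k

/-- Kolmogorov decomposition. -/
theorem exists_kolmogorov [CompleteSpace H] (hA : RPos d A n) (dself : ∀ x, d x x = 0)
    (dsymm : ∀ x y, d x y = d y x) (D : Set X) (hD : ∀ x ∈ D, ∀ y ∈ D, d x y ≤ n) :
    ∃ (K : Type u) (_ : NormedAddCommGroup K) (_ : InnerProductSpace ℂ K) (_ : CompleteSpace K)
      (V : D → H →L[ℂ] K), (∀ x y : D, adjoint (V x) ∘L V y = A (d x y)) ∧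
      DenseRange (Finsupp.lsum ℂ (fun z => (V z).toLinearMap) : (D →₀ H) →ₗ[ℂ] K) := by
  let k : Matrix D D (H →L[ℂ] H) := .of fun x y => A (d x y)
  have hk : k.PosSemidef := by
    have tf := (RKHS.posSemidef_tfae (K := k)).out 0 2
    refine tf.mpr ⟨?_, fun v => ?_⟩
    · ext1 x y
      simp only [Matrix.conjTranspose_apply, k, Matrix.of_apply, star_eq_adjoint]
      rw [hA.adjoint_eq dself dsymm (hD _ y.2 _ x.2), dsymm]
    · have := hA.fintype (fun i : v.support => (i : X)) (fun i j => hD _ i.1.2 _ j.1.2)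
        (fun i => v i)
      have h2 := (Complex.nonneg_iff.1 this).1
      rw [Finset.univ_eq_attach, Finset.sum_attach v.support (fun i => ∑ j ∈ v.support.attach,
        (inner ℂ (v i) (A (d i j) (v j)) : ℂ))] at h2
      convert h2 using 1
      simp only [Finsupp.sum, k, Matrix.of_apply, map_sum, Complex.re_sum]
      refine Finset.sum_congr rfl fun i hi => ?_
      rw [Finset.sum_attach v.support (fun j => (inner ℂ (v i) (A (d i j) (v j)) : ℂ).re)]
      refine Finset.sum_congr rfl fun j hj => ?_
      rw [hA.symm_inner dself dsymm (hD _ j.2 _ i.2), dsymm]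
      rfl
  have : Fact k.PosSemidef := ⟨hk⟩
  refine ⟨RKHS.OfKernel k, inferInstance, inferInstance, inferInstance,
    fun x => RKHS.kerFun (RKHS.OfKernel k) x, fun x y => ?_, ?_⟩
  · rw [← RKHS.kernel_apply, RKHS.OfKernel.kernel_ofKernel]; rfl
  · have := RKHS.kerFun_dense (RKHS.OfKernel k)
    rw [← Submodule.dense_iff_topologicalClosure_eq_top] at this
    refine this.mono ?_
    rw [← LinearMap.coe_range, SetLike.coe_subset_coe, Submodule.span_le]
    rintro _ ⟨x, v, rfl⟩
    exact ⟨Finsupp.single x v, by simp⟩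

end abstract_part

end partA

section partB

open ContinuousLinearMap

section abstract_part2

universe u

variable {X : Type} {d : X → X → ℕ} {H : Type u} [NormedAddCommGroup H] [InnerProductSpace ℂ H]
  {A : ℕ → H →L[ℂ] H} {n : ℕ}

/-- Off-diagonal estimate. -/
theorem RPos.bound (hA : RPos d A n) (dself : ∀ x, d x x = 0)
    (dsymm : ∀ x y, d x y = d y x) {ι : Type*} [Fintype ι] (s : ι → X)
    (hs : ∀ i j, d (s i) (s j) ≤ n) (h : ι → H) (x : X) (hx : ∀ i, d x (s i) ≤ n) :
    ‖∑ i, A (d x (s i)) (h i)‖ ^ 2 ≤ (‖A 0‖ + 1) *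
      (∑ i, ∑ j, (inner ℂ (h i) (A (d (s i) (s j)) (h j)) : ℂ)).re := by
  set w := ∑ i, A (d x (s i)) (h i) with hw
  set Q := ∑ i, ∑ j, (inner ℂ (h i) (A (d (s i) (s j)) (h j)) : ℂ)
  set l : ℝ := (‖A 0‖ + 1)⁻¹ with hl
  have hpos : 0 < ‖A 0‖ + 1 := by positivity
  have hlpos : 0 < l := by positivity
  have h1 := hA.fintype (fun o : Option ι => o.elim x s)
    (by rintro (_ | i) (_ | j) <;> simp [dself, hs, hx, dsymm _ x])
    (fun o => o.elim (-((l : ℂ) • w)) h)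
  simp only [Fintype.sum_option, Option.elim, dself, Finset.sum_add_distrib] at h1
  have e1 : ∑ i, (inner ℂ (-((l : ℂ) • w)) (A (d x (s i)) (h i)) : ℂ) = -(l * ‖w‖ ^ 2 : ℝ) := by
    rw [← inner_sum, ← hw, inner_neg_left, inner_smul_left, inner_self_eq_norm_sq_to_K]
    simp
  have e2 : ∑ i, (inner ℂ (h i) (A (d (s i) x) (-((l : ℂ) • w))) : ℂ) = -(l * ‖w‖ ^ 2 : ℝ) := by
    simp_rw [dsymm _ x, ← hA.symm_inner dself dsymm (hx _)]
    rw [← sum_inner, ← hw, inner_neg_right, inner_smul_right, inner_self_eq_norm_sq_to_K]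
    simp
  have e3 : (inner ℂ (-((l : ℂ) • w)) (A 0 (-((l : ℂ) • w))) : ℂ).re ≤ l ^ 2 * ‖A 0‖ * ‖w‖ ^ 2 := by
    refine (Complex.re_le_norm _).trans ((norm_inner_le_norm _ _).trans ?_)
    refine (mul_le_mul_of_nonneg_left ((A 0).le_opNorm _) (norm_nonneg _)).trans ?_
    rw [norm_neg, norm_smul]
    simp [abs_of_pos hlpos]
    apply le_of_eq; ring
  rw [e1, e2] at h1
  have h2 := (Complex.nonneg_iff.1 h1).1
  simp only [Complex.add_re, Complex.neg_re, Complex.ofReal_re] at h2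
  have h3 : l * ‖A 0‖ ≤ 1 := by
    rw [hl, inv_mul_le_iff₀ hpos]; linarith
  have h4 : l ^ 2 * ‖A 0‖ * ‖w‖ ^ 2 ≤ l * ‖w‖ ^ 2 := by
    have : l ^ 2 * ‖A 0‖ * ‖w‖ ^ 2 = (l * ‖A 0‖) * (l * ‖w‖ ^ 2) := by ring
    rw [this]
    exact mul_le_of_le_one_left (by positivity) h3
  have h5 : l * ‖w‖ ^ 2 ≤ Q.re := by
    linarith
  rw [hl, inv_mul_le_iff₀ hpos] at h5
  exact h5

theorem norm_sq_lsum {ι K : Type*} [NormedAddCommGroup K] [InnerProductSpace ℂ K] [CompleteSpace K]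
    [CompleteSpace H] (V : ι → H →L[ℂ] K) (k : ι → ι → H →L[ℂ] H)
    (hV : ∀ x y, adjoint (V x) ∘L V y = k x y) (e : ι →₀ H) :
    ((‖Finsupp.lsum ℂ (fun z => (V z).toLinearMap) e‖ ^ 2 : ℝ) : ℂ) =
      ∑ i : e.support, ∑ j : e.support, (inner ℂ (e i) (k i j (e j)) : ℂ) := by
  have : Finsupp.lsum ℂ (fun z => (V z).toLinearMap) e = ∑ i : e.support, V i (e i) := by
    rw [Finsupp.lsum_apply, Finsupp.sum, ← Finset.sum_coe_sort]
    rfl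
  rw [this]
  have h2 := inner_self_eq_norm_sq_to_K (𝕜 := ℂ) (∑ i : e.support, V i (e i))
  push_cast
  erw [← h2]
  rw [sum_inner]
  simp_rw [inner_sum, ← hV, ContinuousLinearMap.comp_apply, adjoint_inner_right]

/-- The dilation space of a set `D` of diameter at most `n`, with projected vectors for all points
near `D`. -/
theorem exists_dilation [CompleteSpace H] (hA : RPos d A n) (dself : ∀ x, d x x = 0)
    (dsymm : ∀ x y, d x y = d y x) (D : Set X) (hD : ∀ x ∈ D, ∀ y ∈ D, d x y ≤ n) :
    ∃ (K : Type u) (_ : NormedAddCommGroup K) (_ : InnerProductSpace ℂ K) (_ : CompleteSpace K)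
      (T : X → H →L[ℂ] K), (∀ x ∈ D, ∀ y, (∀ z ∈ D, d y z ≤ n) →
        adjoint (T x) ∘L T y = A (d x y)) ∧
      DenseRange (Finsupp.lsum ℂ (fun z : D => (T z).toLinearMap) : (D →₀ H) →ₗ[ℂ] K) := by
  obtain ⟨K, i1, i2, i3, V, hV, hdense⟩ := exists_kolmogorov hA dself dsymm D hD
  have key : ∀ y : X, ∃ T : H →L[ℂ] K, (∀ hy : y ∈ D, T = V ⟨y, hy⟩) ∧
      ((∀ z ∈ D, d y z ≤ n) → ∀ x : D, adjoint (V x) ∘L T = A (d x y)) := by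
    intro y
    by_cases hy : y ∈ D
    · exact ⟨V ⟨y, hy⟩, fun _ => rfl, fun _ x => hV x ⟨y, hy⟩⟩
    by_cases hn : ∀ z ∈ D, d y z ≤ n
    swap
    · exact ⟨0, fun h => absurd h hy, fun h => absurd h hn⟩
    let f : (D →₀ H) →ₗ[ℂ] K := Finsupp.lsum ℂ (fun z => (V z).toLinearMap)
    let g : (D →₀ H) →ₗ[ℂ] H := Finsupp.lsum ℂ (fun z : D => (A (d y z)).toLinearMap)
    have hb : ∀ e, ‖g e‖ ≤ Real.sqrt (‖A 0‖ + 1) * ‖f e‖ := by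
      intro e
      have h1 := hA.bound dself dsymm (fun i : e.support => (i : X))
        (fun i j => hD _ i.1.2 _ j.1.2) (fun i => e i) y (fun i => hn _ i.1.2)
      have h2 := norm_sq_lsum V (fun x y => A (d x y)) hV e
      rw [← h2, Complex.ofReal_re] at h1
      have h3 : g e = ∑ i : e.support, A (d y i) (e i) := by
        simp only [g]
        rw [Finsupp.lsum_apply, Finsupp.sum, ← Finset.sum_coe_sort]
        rfl
      rw [← h3] at h1
      refine abs_le_of_sq_le_sq' ?_ (by positivity) |>.2
      rw [mul_pow, Real.sq_sqrt (by positivity)]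
      exact h1
    let R := g.extendOfNorm f
    have hR : ∀ e, R (f e) = g e := g.extendOfNorm_eq hdense ⟨_, hb⟩
    refine ⟨adjoint R, fun h => absurd h hy, fun _ x => ?_⟩
    have h4 : R ∘L V x = A (d y x) := by
      ext h
      have := hR (Finsupp.single x h)
      simpa [f, g] using this
    have h5 := congrArg adjoint h4
    rw [adjoint_comp, hA.adjoint_eq dself dsymm (hn _ x.2), dsymm] at h5
    exact h5
  choose T hT1 hT2 using key
  refine ⟨K, i1, i2, i3, T, fun x hx y hy => ?_, ?_⟩
  · rw [hT1 x hx]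
    exact hT2 y hy ⟨x, hx⟩
  · have : (fun z : D => (T z).toLinearMap) = fun z => (V z).toLinearMap := by
      funext z; rw [hT1 z z.2]
    rw [this]; exact hdense

theorem eq_of_dense {ι K : Type*} [NormedAddCommGroup K] [InnerProductSpace ℂ K] [CompleteSpace K]
    [CompleteSpace H] (V : ι → H →L[ℂ] K)
    (hV : DenseRange (Finsupp.lsum ℂ (fun z => (V z).toLinearMap) : (ι →₀ H) →ₗ[ℂ] K))
    {L : Type*} [NormedAddCommGroup L] [InnerProductSpace ℂ L]
    (S T : K →L[ℂ] L) (h : ∀ i, S ∘L V i = T ∘L V i) : S = T := by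
  apply ContinuousLinearMap.coeFn_injective
  apply hV.equalizer S.continuous T.continuous
  funext e
  simp only [Function.comp, Finsupp.lsum_apply, Finsupp.sum, map_sum]
  exact Finset.sum_congr rfl fun i _ => congrArg (fun U : H →L[ℂ] L => U (e i)) (h i)

theorem transfer [CompleteSpace H] {ι K K' : Type*}
    [NormedAddCommGroup K] [InnerProductSpace ℂ K] [CompleteSpace K]
    [NormedAddCommGroup K'] [InnerProductSpace ℂ K'] [CompleteSpace K']
    (V : ι → H →L[ℂ] K) (V' : ι → H →L[ℂ] K')
    (hV : DenseRange (Finsupp.lsum ℂ (fun z => (V z).toLinearMap) : (ι →₀ H) →ₗ[ℂ] K))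
    (hV' : DenseRange (Finsupp.lsum ℂ (fun z => (V' z).toLinearMap) : (ι →₀ H) →ₗ[ℂ] K'))
    (hVV' : ∀ x y, adjoint (V x) ∘L V y = adjoint (V' x) ∘L V' y)
    (S T : H →L[ℂ] K) (S' T' : H →L[ℂ] K')
    (hS : ∀ x, adjoint (V x) ∘L S = adjoint (V' x) ∘L S')
    (hT : ∀ x, adjoint (V x) ∘L T = adjoint (V' x) ∘L T') :
    adjoint S ∘L T = adjoint S' ∘L T' := by
  let f : (ι →₀ H) →ₗ[ℂ] K := Finsupp.lsum ℂ (fun z => (V z).toLinearMap)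
  let f' : (ι →₀ H) →ₗ[ℂ] K' := Finsupp.lsum ℂ (fun z => (V' z).toLinearMap)
  have hb : ∀ e, ‖f' e‖ ≤ 1 * ‖f e‖ := by
    intro e
    have h1 := norm_sq_lsum V _ hVV' e
    have h2 := norm_sq_lsum V' _ (fun x y => rfl) e
    rw [← h2] at h1
    have h3 : ‖f e‖ ^ 2 = ‖f' e‖ ^ 2 := by exact_mod_cast h1
    rw [one_mul]
    exact (abs_le_of_sq_le_sq' h3.ge (norm_nonneg _)).2
  let U := f'.extendOfNorm f
  have hU : ∀ e, U (f e) = f' e := f'.extendOfNorm_eq hV ⟨_, hb⟩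
  have hUV : ∀ x, U ∘L V x = V' x := by
    intro x
    ext h
    have := hU (Finsupp.single x h)
    simpa [f, f'] using this
  have hUV2 : ∀ x, adjoint (V x) ∘L adjoint U = adjoint (V' x) := by
    intro x; rw [← adjoint_comp, hUV]
  have hUU : adjoint U ∘L U = ContinuousLinearMap.id ℂ K := by
    apply eq_of_dense V hV
    intro x
    have : adjoint (adjoint U ∘L U ∘L V x) = adjoint (V x) := by
      apply eq_of_dense V hV
      intro y
      rw [hUV, adjoint_comp, adjoint_adjoint, ContinuousLinearMap.comp_assoc, hUV, hVV']
    have h2 := congrArg adjoint this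
    rw [adjoint_adjoint, adjoint_adjoint] at h2
    exact h2
  have comm : ∀ (S : H →L[ℂ] K) (S' : H →L[ℂ] K'),
      (∀ x, adjoint (V x) ∘L S = adjoint (V' x) ∘L S') → U ∘L S = S' := by
    intro S S' hS
    have : adjoint (U ∘L S) = adjoint S' := by
      apply eq_of_dense V' hV'
      intro x
      have h1 : adjoint (V' x) ∘L (U ∘L S) = adjoint (V' x) ∘L S' := by
        rw [← hS, ← hUV2, ContinuousLinearMap.comp_assoc, ← ContinuousLinearMap.comp_assoc _ U S,
          hUU]
        rfl
      have h2 := congrArg adjoint h1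
      rw [adjoint_comp, adjoint_comp _ S', adjoint_adjoint] at h2
      exact h2
    have h2 := congrArg adjoint this
    rw [adjoint_adjoint, adjoint_adjoint] at h2
    exact h2
  rw [← comm S S' hS, ← comm T T' hT, adjoint_comp, ContinuousLinearMap.comp_assoc,
    ← ContinuousLinearMap.comp_assoc _ U T, hUU]
  rfl

end abstract_part2

end partB

section partC

open ContinuousLinearMap

section abstract_part3

universe u

variable {X : Type} {d : X → X → ℕ} {H : Type u} [NormedAddCommGroup H] [InnerProductSpace ℂ H]
  {A : ℕ → H →L[ℂ] H} {n : ℕ}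

theorem sum_inner_adjoint [CompleteSpace H] {ι K : Type*} [NormedAddCommGroup K]
    [InnerProductSpace ℂ K] [CompleteSpace K] [Fintype ι] (T : ι → H →L[ℂ] K) (h : ι → H) :
    ∑ i, ∑ j, (inner ℂ (h i) ((adjoint (T i) ∘L T j) (h j)) : ℂ) =
      ((‖∑ i, T i (h i)‖ ^ 2 : ℝ) : ℂ) := by
  have h2 := inner_self_eq_norm_sq_to_K (𝕜 := ℂ) (∑ i, T i (h i))
  push_cast
  erw [← h2]
  rw [sum_inner]
  refine Finset.sum_congr rfl fun i _ => ?_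
  rw [inner_sum]
  refine Finset.sum_congr rfl fun j _ => ?_
  exact adjoint_inner_right (T i) (h i) (T j (h j))

theorem schur_nonneg [CompleteSpace H] (hA : RPos d A n) (dself : ∀ x, d x x = 0)
    (dsymm : ∀ x y, d x y = d y x) (D : Set X) (hD : ∀ x ∈ D, ∀ y ∈ D, d x y ≤ n)
    {K : Type*} [NormedAddCommGroup K] [InnerProductSpace ℂ K] [CompleteSpace K]
    (T : X → H →L[ℂ] K) (hT : ∀ x ∈ D, ∀ y, (∀ z ∈ D, d y z ≤ n) →
        adjoint (T x) ∘L T y = A (d x y))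
    (hdense : DenseRange (Finsupp.lsum ℂ (fun z : D => (T z).toLinearMap) : (D →₀ H) →ₗ[ℂ] K))
    {ι : Type*} [Fintype ι] (s : ι → X) (hs : ∀ i j, d (s i) (s j) ≤ n)
    (hs2 : ∀ i, ∀ z ∈ D, d (s i) z ≤ n) (h : ι → H) :
    0 ≤ ∑ i, ∑ j, (inner ℂ (h i) ((A (d (s i) (s j)) - adjoint (T (s i)) ∘L T (s j)) (h j)) : ℂ) := by
  set S := ∑ i, ∑ j,
    (inner ℂ (h i) ((A (d (s i) (s j)) - adjoint (T (s i)) ∘L T (s j)) (h j)) : ℂ) with hS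
  have hT' : ∀ x ∈ D, ∀ y, (∀ z ∈ D, d y z ≤ n) → adjoint (T y) ∘L T x = A (d y x) := by
    intro x hx y hy
    have := congrArg adjoint (hT x hx y hy)
    rwa [adjoint_comp, adjoint_adjoint, dsymm, hA.adjoint_eq dself dsymm (hy x hx)] at this
  set t := ∑ i, T (s i) (h i) with ht
  have key : ∀ e : D →₀ H, 0 ≤ S +
      ((‖t - Finsupp.lsum ℂ (fun z : D => (T z).toLinearMap) e‖ ^ 2 : ℝ) : ℂ) := by
    intro e
    let s' : ι ⊕ e.support → X := Sum.elim s (fun i => (i : X))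
    let h' : ι ⊕ e.support → H := Sum.elim h (fun i => - e i)
    have h1 := hA.fintype s' (by
      rintro (i | i) (j | j)
      · exact hs i j
      · exact hs2 i _ j.1.2
      · simp only [s', Sum.elim_inl, Sum.elim_inr]; rw [dsymm]; exact hs2 j _ i.1.2
      · exact hD _ i.1.2 _ j.1.2) h'
    have h2 := sum_inner_adjoint (fun i => T (s' i)) h'
    have h3 : ∑ i, T (s' i) (h' i) = t - Finsupp.lsum ℂ (fun z : D => (T z).toLinearMap) e := by
      rw [Fintype.sum_sum_type, Finsupp.lsum_apply, Finsupp.sum, ← Finset.sum_coe_sort, ht,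
        sub_eq_add_neg, ← Finset.sum_neg_distrib]
      simp [s', h']
      exact Finset.sum_attach e.support (fun x => T x (e x))
    rw [h3] at h2
    rw [← h2]
    have h4 : S = ∑ i, ∑ j,
        (inner ℂ (h' i) ((A (d (s' i) (s' j)) - adjoint (T (s' i)) ∘L T (s' j)) (h' j)) : ℂ) := by
      have z1 : ∀ (i : ι) (j : e.support),
          A (d (s i) j) - adjoint (T (s i)) ∘L T j = 0 := fun i j => by
        rw [hT' _ j.1.2 _ (hs2 i), sub_self]
      have z2 : ∀ (i : ι) (j : e.support),
          A (d j (s i)) - adjoint (T j) ∘L T (s i) = 0 := fun i j => by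
        rw [hT _ j.1.2 _ (hs2 i), sub_self]
      have z3 : ∀ (i : e.support) (j : e.support),
          A (d i j) - adjoint (T i) ∘L T j = 0 := fun i j => by
        rw [hT _ i.1.2 _ (hD _ j.1.2), sub_self]
      simp only [Fintype.sum_sum_type, s', h', Sum.elim_inl, Sum.elim_inr, z1, z2, z3,
        zero_apply, inner_zero_right, Finset.sum_const_zero, add_zero]
      exact hS
    rw [h4, ← Finset.sum_add_distrib]
    simp_rw [← Finset.sum_add_distrib, ← inner_add_right, ← add_apply,
      sub_add_cancel]
    exact h1
  rw [Complex.nonneg_iff]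
  constructor
  · refine le_of_forall_pos_lt_add fun ε hε => ?_
    obtain ⟨e, he⟩ := hdense.exists_dist_lt t (Real.sqrt_pos.2 hε)
    have h1 := (Complex.nonneg_iff.1 (key e)).1
    rw [dist_eq_norm] at he
    rw [Complex.add_re, Complex.ofReal_re] at h1
    have := Real.lt_sqrt (norm_nonneg _) |>.1 he
    linarith
  · have h1 := (Complex.nonneg_iff.1 (key 0)).2
    rw [Complex.add_im, Complex.ofReal_im, add_zero] at h1
    exact h1

theorem nonneg_of_classes {ι κ : Type*} [Fintype ι] [DecidableEq κ] (cl : ι → κ) (D : ι → ι → ℂ)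
    (h0 : ∀ i j, cl i ≠ cl j → D i j = 0)
    (h1 : ∀ c, 0 ≤ ∑ i : {i // cl i = c}, ∑ j : {i // cl i = c}, D i j) :
    0 ≤ ∑ i, ∑ j, D i j := by
  have hf : ∀ (c : κ) (f : ι → ℂ), ∑ j : {i // cl i = c}, f j =
      ∑ j ∈ Finset.univ.filter (fun j => cl j = c), f j := by
    intro c f
    rw [← Finset.sum_subtype_eq_sum_filter]
    simp
  have : ∑ i, ∑ j, D i j = ∑ c ∈ Finset.univ.image cl,
      ∑ i : {i // cl i = c}, ∑ j : {i // cl i = c}, D i j := by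
    rw [← Finset.sum_fiberwise_of_maps_to (s := Finset.univ) (t := Finset.univ.image cl) (g := cl)
      (fun i _ => Finset.mem_image_of_mem _ (Finset.mem_univ _))]
    refine Finset.sum_congr rfl fun c _ => ?_
    rw [hf c (fun i => ∑ j : {i // cl i = c}, D i j)]
    refine Finset.sum_congr rfl fun i hi => ?_
    rw [hf c (D i)]
    symm
    refine Finset.sum_subset (Finset.filter_subset _ _) fun j _ hj => h0 _ _ ?_
    simp only [Finset.mem_filter, Finset.mem_univ, true_and] at hi hj
    rw [hi]
    exact fun h => hj h.symm
  rw [this]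
  exact Finset.sum_nonneg fun c _ => h1 c

/-- One-step extension. -/
theorem step [CompleteSpace H] (hA : RPos d A n) (dself : ∀ x, d x x = 0)
    (dsymm : ∀ x y, d x y = d y x)
    (four : ∀ x y z w, d x y + d z w ≤ max (d x z + d y w) (d x w + d y z))
    (homog : ∀ u v u' v', d u v = d u' v' →
      ∃ g : X ≃ X, (∀ x y, d (g x) (g y) = d x y) ∧ g u = u' ∧ g v = v') :
    ∃ B, RPos d (Function.update A (n + 1) B) (n + 1) := by
  have upd : ∀ (B : H →L[ℂ] H) k, k ≤ n → Function.update A (n + 1) B k = A k := by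
    intro B k hk
    exact Function.update_of_ne (by omega) _ _
  by_cases hex : ∃ u v, d u v = n + 1
  swap
  · push Not at hex
    refine ⟨0, fun k s hs h => ?_⟩
    have hs' : ∀ i j, d (s i) (s j) ≤ n := fun i j => by
      have := hs i j; have := hex (s i) (s j); omega
    simp_rw [upd 0 _ (hs' _ _)]
    exact hA k s hs' h
  obtain ⟨u₀, v₀, h₀⟩ := hex
  let M : X → X → Set X := fun u v => {z | d z u ≤ n ∧ d z v ≤ n}
  have hMdiam : ∀ u v, d u v = n + 1 → ∀ x ∈ M u v, ∀ y ∈ M u v, d x y ≤ n := by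
    rintro u v huv x ⟨hx1, hx2⟩ y ⟨hy1, hy2⟩
    have := four x y u v
    omega
  obtain ⟨K₀, _, _, _, T₀, hT₀, hd₀⟩ :=
    exists_dilation hA dself dsymm (M u₀ v₀) (hMdiam u₀ v₀ h₀)
  refine ⟨adjoint (T₀ u₀) ∘L T₀ v₀, fun k s hs h => ?_⟩
  set B := adjoint (T₀ u₀) ∘L T₀ v₀ with hB
  by_cases hex2 : ∃ i j, d (s i) (s j) = n + 1
  swap
  · push Not at hex2
    have hs' : ∀ i j, d (s i) (s j) ≤ n := fun i j => by
      have := hs i j; have := hex2 i j; omega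
    simp_rw [upd B _ (hs' _ _)]
    exact hA k s hs' h
  obtain ⟨i₁, j₁, h₁⟩ := hex2
  set u := s i₁ with hu
  set v := s j₁ with hv
  obtain ⟨K, _, _, _, T, hT, hd⟩ := exists_dilation hA dself dsymm (M u v) (hMdiam u v h₁)
  have hT' : ∀ x ∈ M u v, ∀ y, (∀ z ∈ M u v, d y z ≤ n) →
      adjoint (T y) ∘L T x = A (d y x) := by
    intro x hx y hy
    have := congrArg adjoint (hT x hx y hy)
    rwa [adjoint_comp, adjoint_adjoint, dsymm, hA.adjoint_eq dself dsymm (hy x hx)] at this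
  have near : ∀ i, ∀ z ∈ M u v, d (s i) z ≤ n := by
    rintro i z ⟨hz1, hz2⟩
    have := four (s i) z u v
    have : d (s i) u ≤ n + 1 := hs i i₁
    have : d (s i) v ≤ n + 1 := hs i j₁
    omega
  have hMeq : ∀ i j, d (s i) (s j) = n + 1 → M (s i) (s j) = M u v := by
    intro i j hij
    ext z
    constructor
    · rintro ⟨hz1, hz2⟩
      have f1 := four u z (s i) (s j)
      have f2 := four v z (s i) (s j)
      have : d u (s i) ≤ n + 1 := hs i₁ i
      have : d u (s j) ≤ n + 1 := hs i₁ j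
      have : d v (s i) ≤ n + 1 := hs j₁ i
      have : d v (s j) ≤ n + 1 := hs j₁ j
      constructor
      · rw [dsymm]; omega
      · rw [dsymm]; omega
    · intro hz
      exact ⟨by rw [dsymm]; exact near i z hz, by rw [dsymm]; exact near j z hz⟩
  have hBval : ∀ i j, d (s i) (s j) = n + 1 → adjoint (T (s i)) ∘L T (s j) = B := by
    intro i j hij
    obtain ⟨g, hg, hgu, hgv⟩ := homog u₀ v₀ (s i) (s j) (h₀.trans hij.symm)
    have hgM : ∀ z, z ∈ M u₀ v₀ ↔ g z ∈ M u v := by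
      intro z
      rw [← hMeq i j hij]
      simp only [M, Set.mem_ofPred_eq, ← hgu, ← hgv, hg]
    have near0 : ∀ z ∈ M u₀ v₀, d u₀ z ≤ n := fun z hz => by rw [dsymm]; exact hz.1
    have near0' : ∀ z ∈ M u₀ v₀, d v₀ z ≤ n := fun z hz => by rw [dsymm]; exact hz.2
    let ge : M u₀ v₀ ≃ M u v := g.subtypeEquiv hgM
    symm
    apply transfer (fun z : M u₀ v₀ => T₀ z) (fun z : M u₀ v₀ => T (g z)) hd₀
    · refine hd.mono ?_
      rw [← LinearMap.coe_range, ← LinearMap.coe_range, SetLike.coe_subset_coe]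
      rintro _ ⟨e, rfl⟩
      rw [Finsupp.lsum_apply, Finsupp.sum]
      refine Submodule.sum_mem _ fun z _ => ⟨Finsupp.single (ge.symm z) (e z), ?_⟩
      have hz : g (ge.symm z : X) = z := congrArg Subtype.val (ge.apply_symm_apply z)
      simp [hz]
    · intro x y
      rw [hT₀ _ x.2 _ (fun z hz => hMdiam _ _ h₀ _ y.2 _ hz),
        hT _ ((hgM _).1 x.2) _ (fun z hz => hMdiam _ _ h₁ _ ((hgM _).1 y.2) _ hz), hg]
    · intro x
      rw [hT₀ _ x.2 _ near0, hT _ ((hgM _).1 x.2) _ (near i), ← hgu, hg]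
    · intro x
      rw [hT₀ _ x.2 _ near0', hT _ ((hgM _).1 x.2) _ (near j), ← hgv, hg]
  -- decomposition
  have hdec : ∑ i, ∑ j, (inner ℂ (h i) (Function.update A (n + 1) B (d (s i) (s j)) (h j)) : ℂ) =
      ((‖∑ i, T (s i) (h i)‖ ^ 2 : ℝ) : ℂ) + ∑ i, ∑ j, (inner ℂ (h i)
        ((Function.update A (n + 1) B (d (s i) (s j)) -
          adjoint (T (s i)) ∘L T (s j)) (h j)) : ℂ) := by
    rw [← sum_inner_adjoint (fun i => T (s i)) h, ← Finset.sum_add_distrib]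
    simp_rw [← Finset.sum_add_distrib, ← inner_add_right, ← add_apply,
      add_sub_cancel]
  rw [hdec]
  refine add_nonneg (by rw [Complex.zero_le_real]; positivity) ?_
  classical
  let cl : Fin k → Set (Fin k) := fun i =>
    if s i ∈ M u v then ∅ else {j | s j ∉ M u v ∧ d (s i) (s j) ≤ n}
  have trans : ∀ i j l, s j ∉ M u v → d (s i) (s j) ≤ n → d (s j) (s l) ≤ n →
      d (s i) (s l) ≤ n := by
    intro i j l hj hij hjl
    by_contra hcon
    have h3 : d (s i) (s l) = n + 1 := by have := hs i l; omega
    exact hj (by rw [← hMeq i l h3]; exact ⟨by rw [dsymm]; exact hij, hjl⟩)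
  refine nonneg_of_classes cl _ ?_ ?_
  · intro i j hij
    have : Function.update A (n + 1) B (d (s i) (s j)) - adjoint (T (s i)) ∘L T (s j) = 0 := by
      rw [sub_eq_zero]
      by_cases hi : s i ∈ M u v
      · rw [hT _ hi _ (near j), upd]
        rw [dsymm]; exact near j _ hi
      by_cases hj : s j ∈ M u v
      · rw [hT' _ hj _ (near i), upd]
        exact near i _ hj
      by_cases hd : d (s i) (s j) = n + 1
      · rw [hBval i j hd, hd, Function.update_self]
      exfalso
      apply hij
      have hd' : d (s i) (s j) ≤ n := by have := hs i j; omega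
      simp only [cl, hi, hj, if_false]
      ext l
      simp only [Set.mem_ofPred_eq]
      constructor
      · rintro ⟨a, b⟩
        exact ⟨a, trans j i l hi (by rw [dsymm]; exact hd') b⟩
      · rintro ⟨a, b⟩
        exact ⟨a, trans i j l hj hd' b⟩
    rw [this]; simp
  · intro c
    have hcl : ∀ i j : {i // cl i = c}, d (s i) (s j) ≤ n := by
      rintro ⟨i, hi⟩ ⟨j, hj⟩
      by_cases hi' : s i ∈ M u v
      · rw [dsymm]; exact near j _ hi'
      by_cases hj' : s j ∈ M u v
      · exact near i _ hj'
      have : j ∈ cl j := by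
        simp only [cl, hj', if_false, Set.mem_ofPred_eq, dself]
        simp
      rw [hj, ← hi] at this
      simp only [cl, hi', if_false, Set.mem_ofPred_eq] at this
      exact this.2
    have := schur_nonneg hA dself dsymm (M u v) (hMdiam u v h₁) T hT hd
      (fun i : {i // cl i = c} => s i) hcl (fun i => near i) (fun i => h i)
    simp_rw [upd B _ (hcl _ _)]
    exact this

theorem full_extension [CompleteSpace H] (hA : RPos d A n) (dself : ∀ x, d x x = 0)
    (dsymm : ∀ x y, d x y = d y x)
    (four : ∀ x y z w, d x y + d z w ≤ max (d x z + d y w) (d x w + d y z))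
    (homog : ∀ u v u' v', d u v = d u' v' →
      ∃ g : X ≃ X, (∀ x y, d (g x) (g y) = d x y) ∧ g u = u' ∧ g v = v') :
    ∃ A' : ℕ → H →L[ℂ] H, (∀ k ≤ n, A' k = A k) ∧ ∀ N, RPos d A' N := by
  have hst : ∀ (k : ℕ) (a : {a : ℕ → H →L[ℂ] H // RPos d a (n + k)}),
      ∃ b : {b : ℕ → H →L[ℂ] H // RPos d b (n + (k + 1))}, ∀ l ≤ n + k, b.1 l = a.1 l := by
    rintro k ⟨a, ha⟩
    obtain ⟨B, hB⟩ := step ha dself dsymm four homog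
    exact ⟨⟨_, hB⟩, fun l hl => Function.update_of_ne (by omega) _ _⟩
  choose nxt hnxt using hst
  let seq : ∀ k, {a : ℕ → H →L[ℂ] H // RPos d a (n + k)} :=
    fun k => Nat.rec ⟨A, hA⟩ (fun k a => nxt k a) k
  have hseq : ∀ k j, ∀ l ≤ n + k, (seq (k + j)).1 l = (seq k).1 l := by
    intro k j l hl
    induction j with
    | zero => rfl
    | succ j ih => exact (hnxt (k + j) (seq (k + j)) l (by omega)).trans ih
  refine ⟨fun l => (seq l).1 l, fun l hl => ?_, fun N k s hs h => ?_⟩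
  · have := hseq 0 l l (by omega)
    rw [zero_add] at this
    exact this
  · have h1 := (seq N).2 k s (fun i j => (hs i j).trans (by omega)) h
    have h2 : ∀ i j, (seq (d (s i) (s j))).1 (d (s i) (s j)) = (seq N).1 (d (s i) (s j)) := by
      intro i j
      have := hseq (d (s i) (s j)) (N - d (s i) (s j)) (d (s i) (s j)) (by omega)
      rw [Nat.add_sub_cancel' (hs i j)] at this
      exact this.symm
    simp_rw [h2]
    exact h1

end abstract_part3

end partC

section free_part

open FreeGroup

/-- Length of the longest common initial segment. -/
def lcpLen {α : Type*} [DecidableEq α] : List α → List α → ℕ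
  | a :: l, b :: l' => if a = b then lcpLen l l' + 1 else 0
  | _, _ => 0

theorem lcpLen_ultra {α : Type*} [DecidableEq α] (x y z : List α) :
    min (lcpLen x y) (lcpLen y z) ≤ lcpLen x z := by
  induction x generalizing y z with
  | nil => cases y <;> simp [lcpLen]
  | cons a x ih =>
    cases y with
    | nil => simp [lcpLen]
    | cons b y =>
      cases z with
      | nil => simp [lcpLen]
      | cons c z =>
        have := ih y z
        simp only [lcpLen]
        split_ifs <;> first | omega | simp_all

theorem lcpLen_comm {α : Type*} [DecidableEq α] (x y : List α) : lcpLen x y = lcpLen y x := by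
  induction x generalizing y with
  | nil => cases y <;> simp [lcpLen]
  | cons a x ih =>
    cases y with
    | nil => simp [lcpLen]
    | cons b y => simp only [lcpLen, ih y, eq_comm]

variable {m : ℕ}

theorem norm_mk_lcp (x y : List (Fin m × Bool)) (hx : IsReduced x) (hy : IsReduced y) :
    FreeGroup.norm ((mk x)⁻¹ * mk y) + 2 * lcpLen x y = x.length + y.length := by
  induction x generalizing y with
  | nil =>
    have : lcpLen [] y = 0 := by cases y <;> rfl
    rw [this, ← one_eq_mk, inv_one, one_mul, FreeGroup.norm, toWord_mk, hy.reduce_eq]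
    simp
  | cons a x ih =>
    cases y with
    | nil =>
      rw [← one_eq_mk, mul_one, norm_inv_eq, FreeGroup.norm, toWord_mk, hx.reduce_eq]
      simp [lcpLen]
    | cons b y =>
      by_cases hab : a = b
      · subst hab
        have h1 : ∀ l : List (Fin m × Bool), mk (a :: l) = mk [a] * mk l := fun l => by
          rw [mul_mk]; rfl
        have := ih y (List.IsChain.tail hx) (List.IsChain.tail hy)
        rw [h1 x, h1 y]
        simp only [lcpLen, if_true, List.length_cons]
        have h2 : (mk [a] * mk x)⁻¹ * (mk [a] * mk y) = (mk x)⁻¹ * mk y := by group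
        rw [h2]
        omega
      · have hred : IsReduced (invRev x ++ invRev [a] ++ (b :: y)) := by
          apply IsReduced.append_overlap
          · rw [← invRev_cons, isReduced_iff_reduce_eq, reduce_invRev, hx.reduce_eq]
          · simp only [invRev, List.map_cons, List.map_nil, List.reverse_singleton,
              List.singleton_append, isReduced_cons_cons]
            refine ⟨fun h1 => ?_, hy⟩
            rcases a with ⟨a, ea⟩
            rcases b with ⟨b, eb⟩
            simp only at h1
            subst h1
            cases ea <;> cases eb <;> simp_all
          · simp [invRev]
        rw [← invRev_cons] at hred
        rw [inv_mk, mul_mk, FreeGroup.norm, toWord_mk, hred.reduce_eq]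
        simp [lcpLen, hab]

/-- The word metric. -/
def wd (x y : FreeGroup (Fin m)) : ℕ := FreeGroup.norm (x⁻¹ * y)

theorem wd_lcp (x y : FreeGroup (Fin m)) :
    wd x y + 2 * lcpLen x.toWord y.toWord = x.norm + y.norm := by
  have := norm_mk_lcp x.toWord y.toWord isReduced_toWord isReduced_toWord
  rw [mk_toWord, mk_toWord] at this
  exact this

theorem wd_self (x : FreeGroup (Fin m)) : wd x x = 0 := by simp [wd]

theorem wd_symm (x y : FreeGroup (Fin m)) : wd x y = wd y x := by
  rw [wd, wd, ← norm_inv_eq]; simp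

theorem wd_mul (g x y : FreeGroup (Fin m)) : wd (g * x) (g * y) = wd x y := by
  simp only [wd]; congr 1; group

theorem wd_one (x : FreeGroup (Fin m)) : wd 1 x = x.norm := by simp [wd]

theorem wd_four (x y z w : FreeGroup (Fin m)) :
    wd x y + wd z w ≤ max (wd x z + wd y w) (wd x w + wd y z) := by
  have e1 := wd_lcp x y
  have e2 := wd_lcp z w
  have e3 := wd_lcp x z
  have e4 := wd_lcp y w
  have e5 := wd_lcp x w
  have e6 := wd_lcp y z
  have u : ∀ a b c : FreeGroup (Fin m), min (lcpLen a.toWord b.toWord) (lcpLen b.toWord c.toWord) ≤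
    lcpLen a.toWord c.toWord := fun a b c => lcpLen_ultra _ _ _
  have a1 := u x z y
  have a2 := u x w y
  have a3 := u z x w
  have a4 := u z y w
  rw [lcpLen_comm z.toWord y.toWord] at a1 a4
  rw [lcpLen_comm w.toWord y.toWord] at a2
  rw [lcpLen_comm z.toWord x.toWord] at a3
  omega

theorem wd_parity (x y : FreeGroup (Fin m)) : (wd x y + x.norm + y.norm) % 2 = 0 := by
  have e1 := wd_lcp x y
  omega

/-- A letter-permuting involution exchanging two letters. -/
theorem exists_tau (a b : FreeGroup (Fin m)) (ha : a.norm = 1) (hb : b.norm = 1) (hab : a ≠ b) :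
    ∃ t : FreeGroup (Fin m) →* FreeGroup (Fin m), (∀ x, t (t x) = x) ∧
      (∀ x, (t x).norm = x.norm) ∧ t a = b ∧ t b = a := by
  have letter : ∀ a : FreeGroup (Fin m), a.norm = 1 → ∃ i, a = of i ∨ a = (of i)⁻¹ := by
    intro a ha
    obtain ⟨⟨i, e⟩, hl⟩ := List.length_eq_one_iff.1 ha
    refine ⟨i, ?_⟩
    rw [← mk_toWord (x := a), hl]
    cases e
    · right; simp [of, invRev]
    · left; rfl
  have main : ∀ (f : Fin m → FreeGroup (Fin m)), (∀ i, (f i).norm ≤ 1) →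
      (∀ i, lift f (f i) = of i) →
      (∀ x, lift f (lift f x) = x) ∧ (∀ x, (lift f x).norm = x.norm) := by
    intro f hf1 hf2
    have h1 : ∀ x, lift f (lift f x) = x := by
      intro x
      have : (lift f).comp (lift f) = MonoidHom.id _ := by
        ext i; simp [hf2]
      exact DFunLike.congr_fun this x
    have h2 : ∀ x, (lift f x).norm ≤ x.norm := by
      have : ∀ l : List (Fin m × Bool), (lift f (mk l)).norm ≤ l.length := by
        intro l
        induction l with
        | nil => simp [← one_eq_mk]
        | cons p l ih =>
          have : mk (p :: l) = mk [p] * mk l := by rw [mul_mk]; rfl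
          rw [this, _root_.map_mul]
          refine (FreeGroup.norm_mul_le _ _).trans ?_
          have h3 : (lift f (mk [p])).norm ≤ 1 := by
            rcases p with ⟨i, e⟩
            cases e <;> simp [lift_mk, hf1]
          simp only [List.length_cons]
          omega
      intro x
      have h3 := this x.toWord
      rwa [mk_toWord] at h3
    exact ⟨h1, fun x => le_antisymm (h2 x) (by conv_lhs => rw [← h1 x]
                                               exact h2 _)⟩
  obtain ⟨i, hi⟩ := letter a ha
  obtain ⟨j, hj⟩ := letter b hb
  by_cases hij : i = j
  · subst hij
    obtain ⟨h1, h2⟩ := main (fun k => if k = i then (of k)⁻¹ else of k)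
      (fun k => by by_cases h : k = i <;> simp [h])
      (fun k => by by_cases h : k = i <;> simp [h])
    refine ⟨_, h1, h2, ?_⟩
    rcases hi with rfl | rfl <;> rcases hj with rfl | rfl <;> simp_all
  · by_cases hs : (a = of i ∧ b = of j) ∨ (a = (of i)⁻¹ ∧ b = (of j)⁻¹)
    · obtain ⟨h1, h2⟩ := main (fun k => if k = i then of j else if k = j then of i else of k)
        (fun k => by split_ifs <;> simp)
        (fun k => by by_cases h : k = i <;> by_cases h' : k = j <;> simp_all)
      refine ⟨_, h1, h2, ?_⟩
      have hji : j ≠ i := fun h => hij h.symm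
      rcases hs with ⟨rfl, rfl⟩ | ⟨rfl, rfl⟩ <;> simp [hji]
    · obtain ⟨h1, h2⟩ := main
        (fun k => if k = i then (of j)⁻¹ else if k = j then (of i)⁻¹ else of k)
        (fun k => by split_ifs <;> simp)
        (fun k => by by_cases h : k = i <;> by_cases h' : k = j <;> simp_all)
      refine ⟨_, h1, h2, ?_⟩
      have hji : j ≠ i := fun h => hij h.symm
      rcases hi with rfl | rfl <;> rcases hj with rfl | rfl <;> simp_all

theorem exists_rotation (a b q : FreeGroup (Fin m)) (ha : a.norm = 1) (hb : b.norm = 1)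
    (hqa : q.norm ≤ wd a q) (hqb : q.norm ≤ wd b q) :
    ∃ g : FreeGroup (Fin m) ≃ FreeGroup (Fin m), (∀ x y, wd (g x) (g y) = wd x y) ∧
      g 1 = 1 ∧ g q = q ∧ g a = b := by
  classical
  by_cases hab : a = b
  · exact ⟨Equiv.refl _, fun _ _ => rfl, rfl, rfl, hab⟩
  obtain ⟨t, ht1, ht2, hta, htb⟩ := exists_tau a b ha hb hab
  have htd : ∀ x y, wd (t x) (t y) = wd x y := by
    intro x y
    rw [wd, wd, ← _root_.map_inv, ← _root_.map_mul, ht2]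
  let P : FreeGroup (Fin m) → Prop := fun x => wd a x < x.norm ∨ wd b x < x.norm
  have hP : ∀ x, P (t x) ↔ P x := by
    intro x
    have e1 : wd a (t x) = wd b x := by rw [← htb, htd]
    have e2 : wd b (t x) = wd a x := by rw [← hta, htd]
    simp only [P, e1, e2, ht2]
    exact or_comm
  let r : FreeGroup (Fin m) → FreeGroup (Fin m) := fun x => if P x then t x else x
  have hr : Function.Involutive r := by
    intro x
    by_cases hx : P x
    · simp [r, hx, hP, ht1]
    · simp [r, hx]
  have mixed : ∀ x y, P x → ¬ P y → wd x y = x.norm + y.norm := by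
    intro x y hx hy
    simp only [P, not_or, not_lt] at hx hy
    have main : ∀ c : FreeGroup (Fin m), c.norm = 1 → wd c x < x.norm → y.norm ≤ wd c y →
        wd x y = x.norm + y.norm := by
      intro c hc h1 h2
      have p1 := wd_parity c y
      have f1 := wd_four 1 x c y
      have f2 := wd_lcp x y
      have f3 := wd_lcp c y
      simp only [wd_one] at f1
      rw [wd_symm x c] at f1
      omega
    rcases hx with hx | hx
    · exact main a ha hx hy.1
    · exact main b hb hx hy.2
  refine ⟨hr.toPerm, fun x y => ?_, ?_, ?_, ?_⟩
  · show wd (r x) (r y) = wd x y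
    by_cases hx : P x <;> by_cases hy : P y
    · simp [r, hx, hy, htd]
    · have h1 := mixed x y hx hy
      have h2 := mixed (t x) y ((hP x).2 hx) hy
      simp only [r, hx, hy, if_true, if_false]
      rw [h1, h2, ht2]
    · have h1 := mixed y x hy hx
      have h2 := mixed (t y) x ((hP y).2 hy) hx
      simp only [r, hx, hy, if_true, if_false]
      rw [wd_symm, wd_symm x, h1, h2, ht2]
    · simp [r, hx, hy]
  · show r 1 = 1
    simp [r]
  · show r q = q
    have : ¬ P q := by simp only [P]; omega
    simp [r, this]
  · show r a = b
    have : P a := by left; rw [wd_self, ha]; exact one_pos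
    simp [r, this, hta]

theorem sphere_transitive (k : ℕ) (v v' : FreeGroup (Fin m)) (hv : v.norm = k) (hv' : v'.norm = k) :
    ∃ g : FreeGroup (Fin m) ≃ FreeGroup (Fin m), (∀ x y, wd (g x) (g y) = wd x y) ∧
      g 1 = 1 ∧ g v = v' := by
  induction k generalizing v v' with
  | zero =>
    rw [FreeGroup.norm_eq_zero] at hv hv'
    exact ⟨Equiv.refl _, fun _ _ => rfl, rfl, by simp [hv, hv']⟩
  | succ k ih =>
    have split : ∀ v : FreeGroup (Fin m), v.norm = k + 1 → ∃ w, w.norm = k ∧ wd w v = 1 := by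
      intro v hv
      have hne : v.toWord ≠ [] := by
        intro h
        simp [FreeGroup.norm, h] at hv
      have hsplit := List.dropLast_append_getLast hne
      have hred : IsReduced v.toWord.dropLast :=
        List.IsChain.dropLast isReduced_toWord
      refine ⟨mk v.toWord.dropLast, ?_, ?_⟩
      · rw [FreeGroup.norm, toWord_mk, hred.reduce_eq, List.length_dropLast]
        have : v.toWord.length = k + 1 := hv
        omega
      · have : v = mk v.toWord.dropLast * mk [v.toWord.getLast hne] := by
          rw [mul_mk, hsplit, mk_toWord]
        have h2 : (mk v.toWord.dropLast)⁻¹ * v = mk [v.toWord.getLast hne] := by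
          rw [inv_mul_eq_iff_eq_mul]; exact this
        rw [wd, h2, FreeGroup.norm, toWord_mk, reduce_singleton]
        rfl
    obtain ⟨w, hw, hwv⟩ := split v hv
    obtain ⟨w', hw', hwv'⟩ := split v' hv'
    obtain ⟨g, hg, hg1, hgw⟩ := ih w w' hw hw'
    have hp : (g v).norm = k + 1 := by rw [← wd_one, ← hg1, hg, wd_one, hv]
    have hwp : wd w' (g v) = 1 := by rw [← hgw, hg, hwv]
    have e1 : ∀ z : FreeGroup (Fin m), wd (w'⁻¹ * z) w'⁻¹ = z.norm := by
      intro z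
      have := wd_mul w'⁻¹ z 1
      rw [mul_one] at this
      rw [this, wd_symm, wd_one]
    obtain ⟨r, hr, hr1, hrq, hra⟩ := exists_rotation (w'⁻¹ * g v) (w'⁻¹ * v') w'⁻¹ hwp hwv'
      (by rw [e1, norm_inv_eq]; omega) (by rw [e1, norm_inv_eq]; omega)
    refine ⟨g.trans ((Equiv.mulLeft w'⁻¹).trans (r.trans (Equiv.mulLeft w'))), ?_, ?_, ?_⟩
    · intro x y
      simp [wd_mul, hr, hg]
    · simp [hg1, hrq]
    · simp [hra]

theorem wd_homog (u v u' v' : FreeGroup (Fin m)) (h : wd u v = wd u' v') :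
    ∃ g : FreeGroup (Fin m) ≃ FreeGroup (Fin m), (∀ x y, wd (g x) (g y) = wd x y) ∧
      g u = u' ∧ g v = v' := by
  obtain ⟨g, hg, hg1, hgv⟩ := sphere_transitive _ (u⁻¹ * v) (u'⁻¹ * v') rfl h.symm
  refine ⟨(Equiv.mulLeft u⁻¹).trans (g.trans (Equiv.mulLeft u')), ?_, ?_, ?_⟩
  · intro x y
    simp [wd_mul, hg]
  · simp [hg1]
  · simp [hgv]

end free_part

/-- Every radial positive definite `L(H)`-valued function on
`Sₙ = {s : |s| ≤ n}` extends to a radial positive definite function on `F = Fₘ`. -/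
theorem posDef_radial_extension {m n : ℕ} (hn : 1 ≤ n)
    {H : Type*} [NormedAddCommGroup H] [InnerProductSpace ℂ H] [CompleteSpace H]
    (φ : FreeGroup (Fin m) → H →L[ℂ] H)
    (hφ : IsPosDefOn {s : FreeGroup (Fin m) | FreeGroup.norm s ≤ n} φ)
    (hrad : ∀ s t : FreeGroup (Fin m), FreeGroup.norm s ≤ n → FreeGroup.norm t ≤ n →
      FreeGroup.norm s = FreeGroup.norm t → φ s = φ t) :
    ∃ Φ : FreeGroup (Fin m) → H →L[ℂ] H,
      IsPosDefOn (Set.univ : Set (FreeGroup (Fin m))) Φ ∧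
      Set.EqOn Φ φ {s : FreeGroup (Fin m) | FreeGroup.norm s ≤ n} ∧
      ∀ s t : FreeGroup (Fin m), FreeGroup.norm s = FreeGroup.norm t → Φ s = Φ t := by
  classical
  let A : ℕ → H →L[ℂ] H := fun k =>
    if h : ∃ s : FreeGroup (Fin m), s.norm = k then φ h.choose else 0
  have hAφ : ∀ s : FreeGroup (Fin m), s.norm ≤ n → A s.norm = φ s := by
    intro s hs
    have hex : ∃ t : FreeGroup (Fin m), t.norm = s.norm := ⟨s, rfl⟩
    simp only [A, dif_pos hex]
    exact hrad _ _ (hex.choose_spec.trans_le hs) hs hex.choose_spec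
  have hA : RPos (wd (m := m)) A n := by
    intro k s hs h
    rcases k with _ | k
    · simp
    have h1 := hφ (k + 1) (fun i => (s 0)⁻¹ * s i) (fun i => hs 0 i)
      (fun i j => by
        have := hs i j
        rw [← wd_mul (s 0)⁻¹] at this
        exact this) h
    convert h1 using 7 with i _ j _
    rw [← hAφ]
    · congr 1
      exact (wd_mul (s 0)⁻¹ (s i) (s j)).symm
    · exact (wd_mul (s 0)⁻¹ (s i) (s j)).trans_le (hs i j)
  obtain ⟨A', hA', hpos⟩ := full_extension hA wd_self wd_symm wd_four wd_homog
  refine ⟨fun s => A' s.norm, ?_, ?_, fun s t hst => by simp only [hst]⟩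
  · intro k s _ _ h
    exact hpos (∑ i, ∑ j, wd (s i) (s j)) k s (fun i j =>
      (Finset.single_le_sum (f := fun j => wd (s i) (s j)) (fun _ _ => Nat.zero_le _)
        (Finset.mem_univ j)).trans
      (Finset.single_le_sum (f := fun i => ∑ j, wd (s i) (s j)) (fun _ _ => Nat.zero_le _)
        (Finset.mem_univ i))) h
  · intro s hs
    exact (hA' _ hs).trans (hAφ s hs)
end

section
/- Let F = Fₘ be the free group on m generators, H a complex Hilbert space, n ≥ 1, and let M = (M_{s,t})_{s,t ∈ Sₙ} be a family of operators in L(H) indexed by Sₙ × Sₙ which is Toeplitz (M_{s,t} = M_{s',t'} whenever s⁻¹t = s'⁻¹t') and positive semidefinite (Σ_{s,t ∈ Sₙ} ⟨M_{s,t} h_t, h_s⟩ ≥ 0 for every family (h_s)_{s ∈ Sₙ} in H). Then there exists a unique positive definite function φ : S_{2n} → L(H) such that M_{s,t} = φ(s⁻¹t) for all s, t ∈ Sₙ. -/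
open scoped ComplexOrder

theorem norm_mk_of_isReduced {α : Type*} [DecidableEq α] {L : List (α × Bool)}
    (h : FreeGroup.IsReduced L) : FreeGroup.norm (FreeGroup.mk L) = L.length := by
  rw [FreeGroup.norm, FreeGroup.toWord_mk, h.reduce_eq]

/-- A reduced word can be cut at any place, and the cut point is on one of the two geodesics
from any third point to the two endpoints. -/
theorem exists_cut {α : Type*} [DecidableEq α] (w : FreeGroup α) (p q : ℕ)
    (hw : FreeGroup.norm w = p + q) :
    ∃ g : FreeGroup α, FreeGroup.norm g = p ∧ FreeGroup.norm (g⁻¹ * w) = q ∧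
      ∀ y : FreeGroup α, FreeGroup.norm (g * y) = p + FreeGroup.norm y ∨
        FreeGroup.norm (y⁻¹ * (g⁻¹ * w)) = FreeGroup.norm y + q := by
  obtain ⟨A, B, hAB, hA, hB⟩ : ∃ A B : List (α × Bool), w.toWord = A ++ B ∧
      A.length = p ∧ B.length = q := by
    have hl : w.toWord.length = p + q := hw
    refine ⟨w.toWord.take p, w.toWord.drop p, (List.take_append_drop _ _).symm, ?_, ?_⟩
    · simp [hl]
    · simp [hl]
  have hred : FreeGroup.IsReduced (A ++ B) := hAB ▸ FreeGroup.isReduced_toWord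
  have hw' : w = FreeGroup.mk A * FreeGroup.mk B := by
    rw [FreeGroup.mul_mk, ← hAB, FreeGroup.mk_toWord]
  have hred0 := hred
  unfold FreeGroup.IsReduced at hred
  rw [List.isChain_append] at hred
  obtain ⟨rA, rB, rAB⟩ := hred
  have hgw : (FreeGroup.mk A)⁻¹ * w = FreeGroup.mk B := by rw [hw']; group
  refine ⟨FreeGroup.mk A, ?_, ?_, ?_⟩
  · rw [norm_mk_of_isReduced rA, hA]
  · rw [hgw, norm_mk_of_isReduced rB, hB]
  intro y
  rw [hgw]
  have rY : FreeGroup.IsReduced y.toWord := FreeGroup.isReduced_toWord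
  have rYi : FreeGroup.IsReduced (y⁻¹).toWord := FreeGroup.isReduced_toWord
  have hny : FreeGroup.norm y = y.toWord.length := rfl
  by_cases hc : ∀ a ∈ A.getLast?, ∀ b ∈ y.toWord.head?, a.1 = b.1 → a.2 = b.2
  · left
    have : FreeGroup.IsReduced (A ++ y.toWord) := List.isChain_append.2 ⟨rA, rY, hc⟩
    conv_lhs => rw [← FreeGroup.mk_toWord (x := y), FreeGroup.mul_mk, norm_mk_of_isReduced this]
    rw [List.length_append, hA, hny]
  · right
    push Not at hc
    obtain ⟨a, ha, b, hb, hab, hab2⟩ := hc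
    have : FreeGroup.IsReduced ((y⁻¹).toWord ++ B) := by
      refine List.isChain_append.2 ⟨rYi, rB, ?_⟩
      intro c hc d hd hcd
      rw [FreeGroup.toWord_inv, FreeGroup.invRev] at hc
      have h1 := rAB a ha d hd
      simp only [List.getLast?_reverse, List.head?_map, Option.mem_def] at hc hb
      rw [hb] at hc
      simp only [Option.map_some, Option.some.injEq] at hc
      subst hc
      have h2 := h1 (hab.trans hcd)
      simp only
      cases h3 : a.2 <;> cases h4 : b.2 <;> simp_all
    conv_lhs => rw [← FreeGroup.mk_toWord (x := y⁻¹), FreeGroup.mul_mk,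
      norm_mk_of_isReduced this]
    rw [List.length_append, hB, ← FreeGroup.norm_inv_eq (x := y)]
    rfl

/-- A finite set of diameter at most `2 * n` lies in a ball of radius `n`. -/
theorem exists_center {α : Type*} [DecidableEq α] (n k : ℕ) (s : Fin k → FreeGroup α)
    (hs : ∀ i j, FreeGroup.norm ((s i)⁻¹ * s j) ≤ 2 * n) :
    ∃ g : FreeGroup α, ∀ i, FreeGroup.norm (g⁻¹ * s i) ≤ n := by
  rcases Nat.eq_zero_or_pos k with rfl | hk
  · exact ⟨1, fun i => i.elim0⟩
  haveI : Nonempty (Fin k) := ⟨⟨0, hk⟩⟩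
  obtain ⟨⟨i, j⟩, hij⟩ := Finite.exists_max
    (fun p : Fin k × Fin k => FreeGroup.norm ((s p.1)⁻¹ * s p.2))
  simp only [Prod.forall] at hij
  have hD := hs i j
  set D := FreeGroup.norm ((s i)⁻¹ * s j) with hDdef
  obtain ⟨g', hg1, hg2, hg3⟩ := exists_cut ((s i)⁻¹ * s j) (D / 2) (D - D / 2) (by omega)
  refine ⟨s i * g', fun l => ?_⟩
  rcases hg3 ((s i * g')⁻¹ * s l) with h | h
  · have e : g' * ((s i * g')⁻¹ * s l) = (s i)⁻¹ * s l := by group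
    rw [e] at h
    have := hij i l
    omega
  · have e : ((s i * g')⁻¹ * s l)⁻¹ * (g'⁻¹ * ((s i)⁻¹ * s j)) = (s l)⁻¹ * s j := by group
    rw [e] at h
    have := hij l j
    omega

/-- A positive semidefinite Toeplitz family `(M_{s,t})_{s,t ∈ Sₙ}` of
operators is of the form `M_{s,t} = φ(s⁻¹t)` for a unique positive definite function
`φ` on `S_{2n}`. -/
theorem toeplitz_eq_posDef {m n : ℕ} (hn : 1 ≤ n)
    {H : Type*} [NormedAddCommGroup H] [InnerProductSpace ℂ H] [CompleteSpace H]
    (M : FreeGroup (Fin m) → FreeGroup (Fin m) → H →L[ℂ] H)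
    (htoep : ∀ s t s' t' : FreeGroup (Fin m), FreeGroup.norm s ≤ n → FreeGroup.norm t ≤ n →
      FreeGroup.norm s' ≤ n → FreeGroup.norm t' ≤ n → s⁻¹ * t = s'⁻¹ * t' → M s t = M s' t')
    (hpos : ∀ (k : ℕ) (σ : Fin k → FreeGroup (Fin m)), (∀ i, FreeGroup.norm (σ i) ≤ n) →
      ∀ h : Fin k → H, 0 ≤ ∑ i, ∑ j, (inner ℂ (h i) (M (σ i) (σ j) (h j)) : ℂ)) :
    ∃ φ : FreeGroup (Fin m) → H →L[ℂ] H,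
      (IsPosDefOn {s : FreeGroup (Fin m) | FreeGroup.norm s ≤ 2 * n} φ ∧
        ∀ s t : FreeGroup (Fin m), FreeGroup.norm s ≤ n → FreeGroup.norm t ≤ n →
          M s t = φ (s⁻¹ * t)) ∧
      ∀ ψ : FreeGroup (Fin m) → H →L[ℂ] H,
        (IsPosDefOn {s : FreeGroup (Fin m) | FreeGroup.norm s ≤ 2 * n} ψ ∧
          ∀ s t : FreeGroup (Fin m), FreeGroup.norm s ≤ n → FreeGroup.norm t ≤ n →
            M s t = ψ (s⁻¹ * t)) →
        Set.EqOn ψ φ {s : FreeGroup (Fin m) | FreeGroup.norm s ≤ 2 * n} := by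
  classical
  have hsplit : ∀ x : FreeGroup (Fin m), FreeGroup.norm x ≤ 2 * n →
      ∃ u v : FreeGroup (Fin m), FreeGroup.norm u ≤ n ∧ FreeGroup.norm v ≤ n ∧ u⁻¹ * v = x := by
    intro x hx
    obtain ⟨g, h1, h2, -⟩ := exists_cut x (FreeGroup.norm x / 2)
      (FreeGroup.norm x - FreeGroup.norm x / 2) (by omega)
    refine ⟨g⁻¹, g⁻¹ * x, ?_, ?_, by group⟩
    · rw [FreeGroup.norm_inv_eq]; omega
    · omega
  choose! u v hu hv huv using hsplit
  have hnorm : ∀ s t : FreeGroup (Fin m), FreeGroup.norm s ≤ n → FreeGroup.norm t ≤ n →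
      FreeGroup.norm (s⁻¹ * t) ≤ 2 * n := by
    intro s t hs ht
    have := FreeGroup.norm_mul_le s⁻¹ t
    rw [FreeGroup.norm_inv_eq] at this
    omega
  have hM : ∀ s t : FreeGroup (Fin m), FreeGroup.norm s ≤ n → FreeGroup.norm t ≤ n →
      M s t = M (u (s⁻¹ * t)) (v (s⁻¹ * t)) := by
    intro s t hs ht
    have h := hnorm s t hs ht
    exact htoep _ _ _ _ hs ht (hu _ h) (hv _ h) (huv _ h).symm
  refine ⟨fun x => M (u x) (v x), ⟨?_, hM⟩, ?_⟩
  · intro k s _ hs h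
    obtain ⟨g, hg⟩ := exists_center n k s hs
    have h0 := hpos k (fun i => g⁻¹ * s i) hg h
    have e : ∀ i j, M (g⁻¹ * s i) (g⁻¹ * s j) =
        M (u ((s i)⁻¹ * s j)) (v ((s i)⁻¹ * s j)) := by
      intro i j
      have e1 : (g⁻¹ * s i)⁻¹ * (g⁻¹ * s j) = (s i)⁻¹ * s j := by group
      rw [hM _ _ (hg i) (hg j), e1]
    simp only [e] at h0
    exact h0
  · rintro ψ ⟨-, hψ⟩ x hx
    have h := hψ (u x) (v x) (hu x hx) (hv x hx)
    rw [huv x hx] at h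
    exact h.symm
end

section
/- Let F = Fₘ be the free group on m generators, H a complex Hilbert space, Φ : F → L(H) quasi-multiplicative, and (K, π, V) a minimal Naimark dilation of Φ. If s, t ∈ F satisfy |st| = |s| + |t|, then (K({e,s}) ⊖ K({s})) is orthogonal to K({st}); equivalently, for all h, k ∈ H, ⟨Vh − π(s)VV*π(s)*Vh, π(st)Vk⟩ = 0. -/
/-- `K_Φ(Σ)`: the closed linear span of `{π(σ)Vh : σ ∈ Σ, h ∈ H}`. -/
def naimarkSpan {m : ℕ} {H K : Type*} [NormedAddCommGroup H] [InnerProductSpace ℂ H]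
    [NormedAddCommGroup K] [InnerProductSpace ℂ K] [CompleteSpace K]
    (π : FreeGroup (Fin m) →* unitary (K →L[ℂ] K)) (V : H →L[ℂ] K)
    (S : Set (FreeGroup (Fin m))) : Submodule ℂ K :=
  (Submodule.span ℂ
    {x : K | ∃ σ ∈ S, ∃ h : H, x = (π σ : K →L[ℂ] K) (V h)}).topologicalClosure

/-- `(K, π, V)` is a *minimal Naimark dilation* of `Φ`: `π` is a unitary representation,
`V` an isometry, `Φ(s) = V⋆ π(s) V` for all `s`, and `K` is the closed span of
`{π(s)Vh}`. -/
def IsMinimalNaimark {m : ℕ} {H K : Type*}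
    [NormedAddCommGroup H] [InnerProductSpace ℂ H] [CompleteSpace H]
    [NormedAddCommGroup K] [InnerProductSpace ℂ K] [CompleteSpace K]
    (Φ : FreeGroup (Fin m) → H →L[ℂ] H)
    (π : FreeGroup (Fin m) →* unitary (K →L[ℂ] K)) (V : H →L[ℂ] K) : Prop :=
  (∀ h : H, ‖V h‖ = ‖h‖) ∧
  (∀ s : FreeGroup (Fin m),
    Φ s = (ContinuousLinearMap.adjoint V).comp ((π s : K →L[ℂ] K).comp V)) ∧
  naimarkSpan π V (Set.univ : Set (FreeGroup (Fin m))) = ⊤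

/-- `Φ : F → L(H)` is *quasi-multiplicative*: `Φ(e) = I`, `‖Φ(s)‖ ≤ 1`,
`Φ(s⁻¹) = Φ(s)⋆`, and `Φ(st) = Φ(s)Φ(t)` whenever `|st| = |s| + |t|`. -/
def IsQuasiMultiplicative {m : ℕ} {H : Type*}
    [NormedAddCommGroup H] [InnerProductSpace ℂ H] [CompleteSpace H]
    (Φ : FreeGroup (Fin m) → H →L[ℂ] H) : Prop :=
  Φ 1 = 1 ∧ (∀ s : FreeGroup (Fin m), ‖Φ s‖ ≤ 1) ∧
  (∀ s : FreeGroup (Fin m), Φ s⁻¹ = ContinuousLinearMap.adjoint (Φ s)) ∧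
  ∀ s t : FreeGroup (Fin m),
    FreeGroup.norm (s * t) = FreeGroup.norm s + FreeGroup.norm t →
    Φ (s * t) = (Φ s).comp (Φ t)

/-- If `Φ` is quasi-multiplicative with minimal Naimark dilation
`(K, π, V)` and `|st| = |s| + |t|`, then `K({e,s}) ⊖ K({s})` is orthogonal to
`K({st})`; equivalently `⟨Vh − π(s)VV⋆π(s)⋆Vh, π(st)Vk⟩ = 0` for all `h, k ∈ H`. -/
theorem quasiMultiplicative_orthogonality {m : ℕ}
    {H : Type*} [NormedAddCommGroup H] [InnerProductSpace ℂ H] [CompleteSpace H]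
    {K : Type*} [NormedAddCommGroup K] [InnerProductSpace ℂ K] [CompleteSpace K]
    (Φ : FreeGroup (Fin m) → H →L[ℂ] H) (hΦ : IsQuasiMultiplicative Φ)
    (π : FreeGroup (Fin m) →* unitary (K →L[ℂ] K)) (V : H →L[ℂ] K)
    (hmin : IsMinimalNaimark Φ π V)
    (s t : FreeGroup (Fin m))
    (hst : FreeGroup.norm (s * t) = FreeGroup.norm s + FreeGroup.norm t) :
    ∀ h k : H,
      (inner ℂ
        (V h - (π s : K →L[ℂ] K)
          (V ((ContinuousLinearMap.adjoint V)
            ((ContinuousLinearMap.adjoint (π s : K →L[ℂ] K)) (V h)))))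
        ((π (s * t) : K →L[ℂ] K) (V k)) : ℂ) = 0 := by
  intro h k
  obtain ⟨-, -, -, hmul⟩ := hΦ
  obtain ⟨-, hdil, -⟩ := hmin
  have h1 := hmul s t hst
  have hu : (ContinuousLinearMap.adjoint (π s : K →L[ℂ] K)) ((π s : K →L[ℂ] K)
      ((π t : K →L[ℂ] K) (V k))) = (π t : K →L[ℂ] K) (V k) := by
    have h2 := Unitary.coe_star_mul_self (π s)
    rw [ContinuousLinearMap.star_eq_adjoint] at h2
    exact DFunLike.congr_fun h2 ((π t : K →L[ℂ] K) (V k))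
  have hm : (π (s * t) : K →L[ℂ] K) (V k) = (π s : K →L[ℂ] K) ((π t : K →L[ℂ] K) (V k)) := by
    rw [map_mul]; rfl
  have h3 := DFunLike.congr_fun h1 k
  rw [hdil, hdil s, hdil t] at h3
  simp only [ContinuousLinearMap.comp_apply] at h3
  rw [inner_sub_left, sub_eq_zero, ← ContinuousLinearMap.adjoint_inner_right V, h3, hm,
    ← ContinuousLinearMap.adjoint_inner_right (π s : K →L[ℂ] K), hu,
    ← ContinuousLinearMap.adjoint_inner_right V, ContinuousLinearMap.adjoint_inner_left V,
    ContinuousLinearMap.adjoint_inner_left, ContinuousLinearMap.adjoint_inner_right]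
end

section
/- Let F = Fₘ be the free group on m generators, H a complex Hilbert space, Φ : F → L(H) quasi-multiplicative, and (K, π, V) a minimal Naimark dilation of Φ. Then for every n ≥ 1, Φ is maximal (n+1)-orthogonal: for all s, t ∈ F with |s⁻¹t| = n+1, setting Σ = {r ∈ F : max(|r⁻¹s|, |r⁻¹t|) ≤ n}, the subspaces K(Σ ∪ {s}) ⊖ K(Σ) and K(Σ ∪ {t}) ⊖ K(Σ) are mutually orthogonal. (Consequently a quasi-multiplicative function is the central extension of its restriction to S₁.) -/
/-- The dilation `(K, π, V)` is *maximal `(n+1)`-orthogonal*: for all `s, t` with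
`|s⁻¹t| = n + 1`, putting `Σ = {r : max(|r⁻¹s|, |r⁻¹t|) ≤ n}`, the subspaces
`K(Σ ∪ {s}) ⊖ K(Σ)` and `K(Σ ∪ {t}) ⊖ K(Σ)` are mutually orthogonal. -/
def IsMaximalOrthogonal {m : ℕ} {H K : Type*}
    [NormedAddCommGroup H] [InnerProductSpace ℂ H]
    [NormedAddCommGroup K] [InnerProductSpace ℂ K] [CompleteSpace K] (n : ℕ)
    (π : FreeGroup (Fin m) →* unitary (K →L[ℂ] K)) (V : H →L[ℂ] K) : Prop :=
  ∀ s t : FreeGroup (Fin m), FreeGroup.norm (s⁻¹ * t) = n + 1 →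
    ∀ u v : K,
      u ∈ naimarkSpan π V
        ({r | FreeGroup.norm (r⁻¹ * s) ≤ n ∧ FreeGroup.norm (r⁻¹ * t) ≤ n} ∪ {s}) →
      (∀ w ∈ naimarkSpan π V
        {r | FreeGroup.norm (r⁻¹ * s) ≤ n ∧ FreeGroup.norm (r⁻¹ * t) ≤ n},
        (inner ℂ u w : ℂ) = 0) →
      v ∈ naimarkSpan π V
        ({r | FreeGroup.norm (r⁻¹ * s) ≤ n ∧ FreeGroup.norm (r⁻¹ * t) ≤ n} ∪ {t}) →
      (∀ w ∈ naimarkSpan π V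
        {r | FreeGroup.norm (r⁻¹ * s) ≤ n ∧ FreeGroup.norm (r⁻¹ * t) ≤ n},
        (inner ℂ v w : ℂ) = 0) →
      (inner ℂ u v : ℂ) = 0


theorem fg_norm_aux {m : ℕ} (a g : FreeGroup (Fin m)) (x : Fin m × Bool)
    (l : List (Fin m × Bool)) (hg : g.toWord = x :: l)
    (h : FreeGroup.norm (a * g) < FreeGroup.norm g) :
    FreeGroup.norm a = FreeGroup.norm (a * FreeGroup.mk [x]) + 1 := by
  have hredg : FreeGroup.IsReduced (x :: l) := hg ▸ FreeGroup.isReduced_toWord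
  have hreda : FreeGroup.IsReduced a.toWord := FreeGroup.isReduced_toWord
  rcases List.eq_nil_or_concat a.toWord with ha | ⟨L, y, ha⟩
  · rw [FreeGroup.toWord_eq_nil_iff] at ha
    subst ha
    simp at h
  · rw [List.concat_eq_append] at ha
    rw [ha] at hreda
    have haL : a = FreeGroup.mk (L ++ [y]) := by rw [← ha, FreeGroup.mk_toWord]
    by_cases hc : y.1 = x.1 → y.2 = x.2
    · exfalso
      have hred : FreeGroup.IsReduced ((L ++ [y]) ++ (x :: l)) := by
        unfold FreeGroup.IsReduced at *
        rw [List.isChain_append]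
        refine ⟨hreda, hredg, ?_⟩
        simp only [List.getLast?_append, List.getLast?_singleton, List.head?_cons]
        simpa using hc
      have hag : a * g = FreeGroup.mk ((L ++ [y]) ++ (x :: l)) := by
        rw [← FreeGroup.mul_mk, ← haL, ← hg, FreeGroup.mk_toWord]
      have := hred.reduce_eq
      rw [FreeGroup.norm, FreeGroup.norm, hag, FreeGroup.toWord_mk, this, hg] at h
      simp at h
      omega
    · have hy : y = (x.1, !x.2) := by
        obtain ⟨y1, y2⟩ := y
        obtain ⟨x1, x2⟩ := x
        simp only [Classical.not_imp] at hc
        obtain ⟨h1, h2⟩ := hc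
        subst h1
        simp
        cases y2 <;> cases x2 <;> simp_all
      have hL : FreeGroup.IsReduced L := by
        unfold FreeGroup.IsReduced at *
        rw [List.isChain_append] at hreda
        exact hreda.1
      have hax : a * FreeGroup.mk [x] = FreeGroup.mk L := by
        rw [haL, ← FreeGroup.mul_mk, mul_assoc]
        have : FreeGroup.mk [y] = (FreeGroup.mk [x])⁻¹ := by
          rw [FreeGroup.inv_mk, hy]; rfl
        rw [this, inv_mul_cancel, mul_one]
      rw [hax, FreeGroup.norm, FreeGroup.norm, ha, FreeGroup.toWord_mk, hL.reduce_eq]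
      simp

/-- A quasi-multiplicative function `Φ`, via its minimal Naimark
dilation, is maximal `(n+1)`-orthogonal for every `n ≥ 1` (hence it is the central
extension of its restriction to `S₁`). -/
theorem quasiMultiplicative_isMaximalOrthogonal {m : ℕ}
    {H : Type*} [NormedAddCommGroup H] [InnerProductSpace ℂ H] [CompleteSpace H]
    {K : Type*} [NormedAddCommGroup K] [InnerProductSpace ℂ K] [CompleteSpace K]
    (Φ : FreeGroup (Fin m) → H →L[ℂ] H) (hΦ : IsQuasiMultiplicative Φ)
    (π : FreeGroup (Fin m) →* unitary (K →L[ℂ] K)) (V : H →L[ℂ] K)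
    (hmin : IsMinimalNaimark Φ π V) :
    ∀ n : ℕ, 1 ≤ n → IsMaximalOrthogonal n π V := by
  intro n hn s t hst u v hu _ hv hv0
  obtain ⟨hΦ1, _, hΦadj, hmul⟩ := hΦ
  obtain ⟨_, hdil, _⟩ := hmin
  -- the Gram kernel
  have gram : ∀ (r q : FreeGroup (Fin m)) (h k : H),
      inner ℂ ((π r : K →L[ℂ] K) (V h)) ((π q : K →L[ℂ] K) (V k))
        = inner ℂ h (Φ (r⁻¹ * q) k) := by
    intro r q h k
    rw [hdil, ContinuousLinearMap.comp_apply, ContinuousLinearMap.adjoint_inner_right,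
      ContinuousLinearMap.comp_apply, map_mul, map_inv, Submonoid.coe_mul,
      mul_apply_eq_comp, ← Unitary.star_eq_inv, Unitary.coe_star,
      ContinuousLinearMap.star_eq_adjoint, ContinuousLinearMap.adjoint_inner_right]
  obtain ⟨x, l, hg⟩ : ∃ x l, (s⁻¹ * t).toWord = x :: l := by
    rcases hw : (s⁻¹ * t).toWord with _ | ⟨x, l⟩
    · rw [FreeGroup.norm, hw] at hst
      simp at hst
    · exact ⟨x, l, rfl⟩
  set p := s * FreeGroup.mk [x] with hp
  have key : ∀ r : FreeGroup (Fin m), FreeGroup.norm (r⁻¹ * t) ≤ n →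
      FreeGroup.norm (r⁻¹ * s) = FreeGroup.norm (r⁻¹ * p) + 1 := by
    intro r hr
    have h := fg_norm_aux (r⁻¹ * s) (s⁻¹ * t) x l hg (by
      rw [hst]; simpa [mul_assoc] using Nat.lt_succ_of_le hr)
    rw [hp, ← mul_assoc]
    exact h
  have hpx : p⁻¹ * s = (FreeGroup.mk [x])⁻¹ := by rw [hp]; group
  have hps : FreeGroup.norm (p⁻¹ * s) = 1 := by
    rw [hpx, FreeGroup.norm_inv_eq, FreeGroup.norm, FreeGroup.toWord_mk]
    simp
  have hpt : FreeGroup.norm (p⁻¹ * t) ≤ n := by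
    have h1 : p⁻¹ * t = FreeGroup.mk l := by
      have h2 : s⁻¹ * t = FreeGroup.mk [x] * FreeGroup.mk l := by
        rw [FreeGroup.mul_mk, List.singleton_append, ← hg, FreeGroup.mk_toWord]
      rw [hp, mul_inv_rev, mul_assoc, h2]; group
    rw [h1]
    refine FreeGroup.norm_mk_le.trans ?_
    rw [FreeGroup.norm, hg] at hst
    simp at hst
    omega
  have orth : ∀ r : FreeGroup (Fin m), FreeGroup.norm (r⁻¹ * t) ≤ n → ∀ h k : H,
      inner ℂ ((π r : K →L[ℂ] K) (V k)) ((π s : K →L[ℂ] K) (V h)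
        - (π p : K →L[ℂ] K) (V (Φ (p⁻¹ * s) h))) = 0 := by
    intro r hr h k
    have h1 : r⁻¹ * s = (r⁻¹ * p) * (p⁻¹ * s) := by group
    have h2 := hmul (r⁻¹ * p) (p⁻¹ * s) (by rw [← h1, hps]; exact key r hr)
    rw [inner_sub_right, gram, gram, h1, h2]
    simp
  have closure_ind : ∀ (S : Set (FreeGroup (Fin m))) (y z : K), z ∈ naimarkSpan π V S →
      (∀ r ∈ S, ∀ h : H, inner ℂ y ((π r : K →L[ℂ] K) (V h)) = 0) → inner ℂ y z = 0 := by
    intro S y z hz hS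
    have hle : naimarkSpan π V S ≤ (ℂ ∙ y)ᗮ := by
      refine Submodule.topologicalClosure_minimal _ ?_ (Submodule.isClosed_orthogonal _)
      rw [Submodule.span_le]
      rintro _ ⟨r, hr, h, rfl⟩
      exact Submodule.mem_orthogonal_singleton_iff_inner_right.2 (hS r hr h)
    exact Submodule.mem_orthogonal_singleton_iff_inner_right.1 (hle hz)
  have memS : ∀ r : FreeGroup (Fin m), FreeGroup.norm (r⁻¹ * s) ≤ n →
      FreeGroup.norm (r⁻¹ * t) ≤ n → ∀ h : H, inner ℂ v ((π r : K →L[ℂ] K) (V h)) = 0 := by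
    intro r h1 h2 h
    exact hv0 _ (Submodule.le_topologicalClosure _
      (Submodule.subset_span ⟨r, ⟨h1, h2⟩, h, rfl⟩))
  rw [inner_eq_zero_symm]
  refine closure_ind _ v u hu ?_
  rintro r (hr | hr) h
  · exact memS r hr.1 hr.2 h
  · rw [Set.mem_singleton_iff] at hr
    subst hr
    have h1 := memS p (by omega) hpt (Φ (p⁻¹ * r) h)
    have h2 : inner ℂ v ((π r : K →L[ℂ] K) (V h)
        - (π p : K →L[ℂ] K) (V (Φ (p⁻¹ * r) h))) = 0 := by
      rw [inner_eq_zero_symm]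
      refine closure_ind _ _ v hv ?_
      rintro q (hq | hq) k
      · rw [inner_eq_zero_symm]
        exact orth q hq.2 h k
      · rw [Set.mem_singleton_iff] at hq
        rw [inner_eq_zero_symm]
        exact orth q (by rw [hq]; simp) h k
    rw [inner_sub_right, h1, sub_zero] at h2
    exact h2
end

section
/- Let F = Fₘ be the free group on m generators, H a complex Hilbert space, and φ : S₁ → L(H) with φ(e) = I_H. Then φ is positive definite on S₁ if and only if φ(s⁻¹) = φ(s)* and ‖φ(s)‖ ≤ 1 for all s ∈ S₁. -/
open scoped ComplexOrder

lemma aux_ball {m : ℕ} (s t : FreeGroup (Fin m)) (hs1 : s ≠ 1) (ht1 : t ≠ 1)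
    (hs : FreeGroup.norm s ≤ 1) (ht : FreeGroup.norm t ≤ 1)
    (hst : FreeGroup.norm (s⁻¹ * t) ≤ 1) : s = t := by
  have key : ∀ u : FreeGroup (Fin m), u ≠ 1 → FreeGroup.norm u ≤ 1 →
      ∃ a : Fin m × Bool, u = FreeGroup.mk [a] := by
    intro u hu hn
    have h0 : FreeGroup.norm u ≠ 0 := fun h => hu (FreeGroup.norm_eq_zero.1 h)
    have h1 : u.toWord.length = 1 := by
      have : FreeGroup.norm u = u.toWord.length := rfl
      omega
    obtain ⟨a, ha⟩ := List.length_eq_one_iff.1 h1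
    exact ⟨a, by rw [← ha, FreeGroup.mk_toWord]⟩
  obtain ⟨⟨a, x⟩, rfl⟩ := key s hs1 hs
  obtain ⟨⟨b, y⟩, rfl⟩ := key t ht1 ht
  by_cases h : a = b ∧ x = y
  · rw [h.1, h.2]
  · exfalso
    have : FreeGroup.norm ((FreeGroup.mk [(a, x)])⁻¹ * FreeGroup.mk [(b, y)]) = 2 := by
      simp [FreeGroup.inv_mk, FreeGroup.mul_mk, FreeGroup.norm, FreeGroup.toWord_mk,
        FreeGroup.invRev, FreeGroup.reduce.cons, h]
    omega

lemma aux_pos {H : Type*} [NormedAddCommGroup H] [InnerProductSpace ℂ H] [CompleteSpace H]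
    (T : H →L[ℂ] H) (hT : ‖T‖ ≤ 1) (u v : H) :
    0 ≤ (inner ℂ u u + inner ℂ u (T v) + inner ℂ v (ContinuousLinearMap.adjoint T u)
      + inner ℂ v v : ℂ) := by
  have h1 : (inner ℂ u u + inner ℂ u (T v) + inner ℂ v (ContinuousLinearMap.adjoint T u)
      + inner ℂ v v : ℂ) = ((‖u + T v‖ ^ 2 + (‖v‖ ^ 2 - ‖T v‖ ^ 2) : ℝ) : ℂ) := by
    have e1 := inner_self_eq_norm_sq_to_K (𝕜 := ℂ) (u + T v)
    have e2 := inner_self_eq_norm_sq_to_K (𝕜 := ℂ) v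
    have e3 := inner_self_eq_norm_sq_to_K (𝕜 := ℂ) (T v)
    simp only [Complex.coe_algebraMap] at e1 e2 e3
    push_cast
    rw [← e1, ← e2, ← e3, ContinuousLinearMap.adjoint_inner_right]
    simp only [inner_add_left, inner_add_right]
    ring
  rw [h1]
  have h2 : ‖T v‖ ≤ ‖v‖ := by
    calc ‖T v‖ ≤ ‖T‖ * ‖v‖ := T.le_opNorm v
      _ ≤ 1 * ‖v‖ := by gcongr
      _ = ‖v‖ := one_mul _
  have h3 : ‖T v‖ ^ 2 ≤ ‖v‖ ^ 2 := by gcongr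
  have : 0 ≤ ‖u + T v‖ ^ 2 + (‖v‖ ^ 2 - ‖T v‖ ^ 2) := by
    have := sq_nonneg ‖u + T v‖
    linarith
  exact_mod_cast this

lemma aux_conv {H : Type*} [NormedAddCommGroup H] [InnerProductSpace ℂ H] [CompleteSpace H]
    (A B : H →L[ℂ] H)
    (h : ∀ x y : H, 0 ≤ (inner ℂ x x + inner ℂ x (A y) + (inner ℂ y (B x) + inner ℂ y y) : ℂ)) :
    B = ContinuousLinearMap.adjoint A ∧ ‖A‖ ≤ 1 := by
  have him : ∀ x : H, (inner ℂ x x : ℂ).im = 0 := fun x => inner_self_im (𝕜 := ℂ) x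
  have hB : B = ContinuousLinearMap.adjoint A := by
    rw [ContinuousLinearMap.eq_adjoint_iff]
    intro x y
    have h1 := (Complex.nonneg_iff.1 (h x y)).2
    have h2 := (Complex.nonneg_iff.1 (h x (Complex.I • y))).2
    simp only [map_smul, inner_smul_left, inner_smul_right, Complex.add_im, him, Complex.mul_im,
      Complex.mul_re, Complex.conj_I, Complex.I_re, Complex.I_im, Complex.neg_re,
      Complex.neg_im] at h1 h2
    rw [← inner_conj_symm (B x) y]
    apply Complex.ext
    · simp only [Complex.conj_re]; linarith
    · simp only [Complex.conj_im]; linarith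
  refine ⟨hB, ?_⟩
  refine A.opNorm_le_bound zero_le_one fun y => ?_
  have h1 := (Complex.nonneg_iff.1 (h (-(A y)) y)).1
  rw [hB, ContinuousLinearMap.adjoint_inner_right] at h1
  have e2 : (inner ℂ y y : ℂ).re = ‖y‖ ^ 2 := inner_self_eq_norm_sq (𝕜 := ℂ) y
  have e3 : (inner ℂ (A y) (A y) : ℂ).re = ‖A y‖ ^ 2 := inner_self_eq_norm_sq (𝕜 := ℂ) (A y)
  simp only [inner_neg_left, inner_neg_right, Complex.add_re, Complex.neg_re, e2, e3] at h1
  rw [one_mul]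
  exact le_of_sq_le_sq (by linarith) (norm_nonneg _)

/-- A function `φ : S₁ → L(H)` with `φ(e) = I` is positive definite on
`S₁ = {s : |s| ≤ 1}` if and only if `φ(s⁻¹) = φ(s)⋆` and `‖φ(s)‖ ≤ 1` for all `s ∈ S₁`. -/
theorem posDefOn_ball_one_iff {m : ℕ}
    {H : Type*} [NormedAddCommGroup H] [InnerProductSpace ℂ H] [CompleteSpace H]
    (φ : FreeGroup (Fin m) → H →L[ℂ] H) (hφ1 : φ 1 = 1) :
    IsPosDefOn {s : FreeGroup (Fin m) | FreeGroup.norm s ≤ 1} φ ↔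
      ∀ s : FreeGroup (Fin m), FreeGroup.norm s ≤ 1 →
        φ s⁻¹ = ContinuousLinearMap.adjoint (φ s) ∧ ‖φ s‖ ≤ 1 := by
  constructor
  · intro hp s hs
    apply aux_conv
    intro x y
    have := hp 2 ![1, s] (by simp [Fin.forall_fin_two, hs])
      (by simp [Fin.forall_fin_two, hs]) ![x, y]
    simpa [Fin.sum_univ_two, hφ1] using this
  · intro hp k s hs hss h
    simp only [Set.mem_ofPred_eq] at hs hss
    obtain ⟨g, hg, hsg⟩ : ∃ g : FreeGroup (Fin m), FreeGroup.norm g ≤ 1 ∧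
        ∀ i, s i = 1 ∨ s i = g := by
      by_cases hall : ∀ i, s i = 1
      · exact ⟨1, by simp, fun i => Or.inl (hall i)⟩
      · push Not at hall
        obtain ⟨i, hi⟩ := hall
        refine ⟨s i, hs i, fun j => ?_⟩
        by_cases hj : s j = 1
        · exact Or.inl hj
        · exact Or.inr (aux_ball _ _ hj hi (hs j) (hs i) (hss j i))
    obtain ⟨hadj, hnorm⟩ := hp g hg
    let a : Fin k → H := fun i => if s i = 1 then h i else 0
    let b : Fin k → H := fun i => if s i = 1 then 0 else h i
    have hterm : ∀ i j, (inner ℂ (h i) (φ ((s i)⁻¹ * s j) (h j)) : ℂ) =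
        inner ℂ (a i) (a j) + inner ℂ (a i) (φ g (b j)) + inner ℂ (b i) (φ g⁻¹ (a j))
          + inner ℂ (b i) (b j) := by
      intro i j
      by_cases hi : s i = 1 <;> by_cases hj : s j = 1
      · simp [a, b, hi, hj, hφ1]
      · have hj' := (hsg j).resolve_left hj
        rw [hj'] at hj
        simp [a, b, hi, hj, hj']
      · have hi' := (hsg i).resolve_left hi
        rw [hi'] at hi
        simp [a, b, hi, hj, hi']
      · have hj' := (hsg j).resolve_left hj
        have hi' := (hsg i).resolve_left hi
        rw [hi'] at hi
        simp [a, b, hi, hj', hi', hφ1]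
    have := aux_pos (φ g) hnorm (∑ i, a i) (∑ i, b i)
    rw [← hadj] at this
    simp only [hterm]
    rw [Finset.sum_comm]
    simpa only [map_sum, sum_inner, inner_sum, Finset.sum_add_distrib] using this
end

section
/- Let F = Fₘ be the free group on generators a₁,…,aₘ, C a complex Hilbert space, d ≥ 1, and p(X) = Σ_{|x| ≤ d} A_x X(x) a positive noncommutative polynomial with coefficients A_x ∈ L(C) (positivity meaning: for every complex Hilbert space X, unitaries U₁,…,Uₘ on X, and all finite families h₁,…,h_k ∈ C, x₁,…,x_k ∈ X, Σ_{i,j} Σ_{|x| ≤ d} ⟨A_x h_j, h_i⟩⟨U(x)x_j, x_i⟩ ≥ 0). Then there exist finitely many polynomials Q₁,…,Q_N with coefficients in L(C), each supported on words of length ≤ d, such that p(X) = Σ_{j=1}^N Q_j(X)*Q_j(X); that is, writing Q_j(X) = Σ_{s ∈ S_d} B_s^{(j)} X(s) with B_s^{(j)} ∈ L(C), for every x ∈ F the sum Σ_{j=1}^N Σ_{s,t ∈ S_d, s⁻¹t = x} (B_s^{(j)})* B_t^{(j)} equals A_x if |x| ≤ d and 0 if |x| > d. -/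
open scoped ComplexOrder

/-- A bundled complex Hilbert space. -/
structure BundledHilbertSpace where
  carrier : Type
  [normed : NormedAddCommGroup carrier]
  [ips : InnerProductSpace ℂ carrier]
  [complete : CompleteSpace carrier]

attribute [instance] BundledHilbertSpace.normed BundledHilbertSpace.ips BundledHilbertSpace.complete

namespace SOS

/-- Two families with the same Gram matrix are related by a unitary. -/
theorem exists_unitary_of_gram {X : Type*} [NormedAddCommGroup X] [InnerProductSpace ℂ X]
    [FiniteDimensional ℂ X] [CompleteSpace X] {J : Type*} [Fintype J] (u w : J → X)
    (hg : ∀ i j, inner ℂ (u i) (u j) = inner ℂ (w i) (w j)) :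
    ∃ U : unitary (X →L[ℂ] X), ∀ j, (U : X →L[ℂ] X) (u j) = w j := by
  classical
  let Φu := Fintype.linearCombination ℂ u
  let Φw := Fintype.linearCombination ℂ w
  have hin : ∀ c, inner ℂ (Φu c) (Φu c) = inner ℂ (Φw c) (Φw c) := by
    intro c
    simp only [Φu, Φw, Fintype.linearCombination_apply, sum_inner, inner_sum, inner_smul_left,
      inner_smul_right, hg]
  have hnorm : ∀ c, ‖Φu c‖ = ‖Φw c‖ := by
    intro c
    have := hin c
    rw [inner_self_eq_norm_sq_to_K, inner_self_eq_norm_sq_to_K] at this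
    have h2 : ‖Φu c‖ ^ 2 = ‖Φw c‖ ^ 2 := by exact_mod_cast this
    exact (sq_eq_sq₀ (norm_nonneg _) (norm_nonneg _)).1 h2
  have hker : LinearMap.ker Φu ≤ LinearMap.ker Φw := by
    intro c hc
    rw [LinearMap.mem_ker] at hc ⊢
    rw [← norm_eq_zero, ← hnorm, hc, norm_zero]
  obtain ⟨g, hg2⟩ : ∃ g : X →ₗ[ℂ] X, g.comp Φu = Φw := by
    obtain ⟨r, hr⟩ := (Φu.rangeRestrict).exists_rightInverse_of_surjective Φu.range_rangeRestrict
    obtain ⟨q, hq⟩ := LinearMap.exists_leftInverse_of_injective (LinearMap.range Φu).subtype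
      (Submodule.ker_subtype _)
    refine ⟨Φw.comp (r.comp q), ?_⟩
    ext1 j
    ext1
    set c : J → ℂ := LinearMap.single ℂ (fun _ => ℂ) j 1
    have h1 : q (Φu c) = Φu.rangeRestrict c := by
      have := LinearMap.congr_fun hq (Φu.rangeRestrict c)
      simpa using this
    have h2 : Φu (r (Φu.rangeRestrict c) - c) = 0 := by
      have := congrArg Subtype.val (LinearMap.congr_fun hr (Φu.rangeRestrict c))
      rw [map_sub, sub_eq_zero]
      simpa using this
    have h3 : Φw (r (Φu.rangeRestrict c) - c) = 0 := hker h2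
    rw [map_sub, sub_eq_zero] at h3
    simp only [LinearMap.comp_apply]
    rw [h1]; exact h3
  let L : LinearMap.range Φu →ₗᵢ[ℂ] X :=
    { toLinearMap := g.comp (LinearMap.range Φu).subtype
      norm_map' := by
        rintro ⟨_, c, rfl⟩
        have := LinearMap.congr_fun hg2 c
        simp only [LinearMap.comp_apply] at this
        simp [this, hnorm] }
  let e := L.extend.toLinearIsometryEquiv rfl
  refine ⟨Unitary.linearIsometryEquiv.symm e, fun j => ?_⟩
  have hu : Φu (Pi.single j 1) = u j := by simp [Φu]
  have hw : Φw (Pi.single j 1) = w j := by simp [Φw]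
  have h1 := L.extend_apply ⟨Φu (Pi.single j 1), ⟨_, rfl⟩⟩
  have h2 := LinearMap.congr_fun hg2 (Pi.single j 1)
  have h3 : L.extend (u j) = w j := by
    rw [← hu, ← hw, ← h2]; exact h1
  simpa [e] using h3

/-- The word-length ball is finite. -/
theorem ball_finite (m d : ℕ) : {s : FreeGroup (Fin m) | FreeGroup.norm s ≤ d}.Finite := by
  have h := List.finite_length_le (Fin m × Bool) d
  exact Set.Finite.preimage (FreeGroup.toWord_injective.injOn) h

theorem word_orbit {m d : ℕ} {X : Type*} [NormedAddCommGroup X] [InnerProductSpace ℂ X]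
    [CompleteSpace X] (v : FreeGroup (Fin m) → X) (U : Fin m → unitary (X →L[ℂ] X))
    (hU : ∀ a s, FreeGroup.norm s ≤ d → FreeGroup.norm (FreeGroup.of a * s) ≤ d →
      (U a : X →L[ℂ] X) (v s) = v (FreeGroup.of a * s))
    (s : FreeGroup (Fin m)) (hs : FreeGroup.norm s ≤ d) :
    (FreeGroup.lift U s : X →L[ℂ] X) (v 1) = v s := by
  have key : ∀ L : List (Fin m × Bool), FreeGroup.IsReduced L → L.length ≤ d →
      (FreeGroup.lift U (FreeGroup.mk L) : X →L[ℂ] X) (v 1) = v (FreeGroup.mk L) := by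
    intro L
    induction L with
    | nil => intro _ _; simp [← FreeGroup.one_eq_mk]
    | cons p L ih =>
      obtain ⟨a, b⟩ := p
      intro hred hlen
      have hredL : FreeGroup.IsReduced L := by
        unfold FreeGroup.IsReduced at hred ⊢
        exact hred.tail
      have hlen' : L.length ≤ d := by simp at hlen; omega
      have ih' := ih hredL hlen'
      have n1 : FreeGroup.norm (FreeGroup.mk L) ≤ d := le_trans FreeGroup.norm_mk_le hlen'
      have n2 : FreeGroup.norm (FreeGroup.mk ((a, b) :: L)) ≤ d :=
        le_trans FreeGroup.norm_mk_le hlen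
      cases b with
      | true =>
        have e : FreeGroup.mk ((a, true) :: L) = FreeGroup.of a * FreeGroup.mk L := by
          simp [FreeGroup.of, FreeGroup.mul_mk]
        rw [e] at n2 ⊢
        rw [map_mul, FreeGroup.lift_apply_of]
        rw [Submonoid.coe_mul, mul_apply_eq_comp, ih', hU a _ n1 n2]
      | false =>
        have e : FreeGroup.mk ((a, false) :: L) = (FreeGroup.of a)⁻¹ * FreeGroup.mk L := by
          simp [FreeGroup.of, FreeGroup.mul_mk, FreeGroup.inv_mk, FreeGroup.invRev]
        have e2 : FreeGroup.of a * FreeGroup.mk ((a, false) :: L) = FreeGroup.mk L := by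
          rw [e]; simp
        have h := hU a _ n2 (by rw [e2]; exact n1)
        rw [e2] at h
        rw [e] at h ⊢
        rw [map_mul, map_inv, FreeGroup.lift_apply_of]
        have : ((U a)⁻¹ * FreeGroup.lift U (FreeGroup.mk L) : unitary (X →L[ℂ] X)) =
            ((U a)⁻¹ : unitary (X →L[ℂ] X)) * FreeGroup.lift U (FreeGroup.mk L) := rfl
        have h4 : (((U a)⁻¹ : unitary (X →L[ℂ] X)) : X →L[ℂ] X) ((U a : X →L[ℂ] X)
            (v ((FreeGroup.of a)⁻¹ * FreeGroup.mk L))) = v ((FreeGroup.of a)⁻¹ * FreeGroup.mk L) := by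
          have : (((U a)⁻¹ : unitary (X →L[ℂ] X)) : X →L[ℂ] X) * (U a : X →L[ℂ] X) = 1 := by
            rw [← Submonoid.coe_mul]; simp
          rw [← mul_apply_eq_comp, this]; rfl
        rw [Submonoid.coe_mul, mul_apply_eq_comp, ih', ← h, h4]
  have := key s.toWord FreeGroup.isReduced_toWord hs
  rwa [FreeGroup.mk_toWord] at this

/-- The positivity hypothesis of the main theorem. -/
def IsPos {m : ℕ} {C : Type*} [NormedAddCommGroup C] [InnerProductSpace ℂ C]
    (A : FreeGroup (Fin m) →₀ (C →L[ℂ] C)) : Prop :=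
  ∀ (X : BundledHilbertSpace)
      (U : Fin m → unitary (X.carrier →L[ℂ] X.carrier))
      (k : ℕ) (h : Fin k → C) (ξ : Fin k → X.carrier),
      0 ≤ ∑ i, ∑ j, ∑ x ∈ A.support,
        (inner ℂ (h i) (A x (h j)) : ℂ) *
        (inner ℂ (ξ i)
          ((FreeGroup.lift U x : X.carrier →L[ℂ] X.carrier) (ξ j)) : ℂ)

theorem pos_pairing {m d : ℕ}
    {C : Type*} [NormedAddCommGroup C] [InnerProductSpace ℂ C]
    (A : FreeGroup (Fin m) →₀ (C →L[ℂ] C))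
    (hdeg : ∀ x : FreeGroup (Fin m), d < FreeGroup.norm x → A x = 0)
    (hpos : IsPos A) {X : Type} [NormedAddCommGroup X] [InnerProductSpace ℂ X]
    [FiniteDimensional ℂ X] {k : ℕ} (h : Fin k → C)
    (ψ : Fin k → Fin k → FreeGroup (Fin m) → ℂ) (v : Fin k → FreeGroup (Fin m) → X)
    (hv : ∀ i j s t, FreeGroup.norm s ≤ d → FreeGroup.norm t ≤ d →
      inner ℂ (v i s) (v j t) = ψ i j (s⁻¹ * t)) :
    0 ≤ ∑ i, ∑ j, ∑ x ∈ A.support, (inner ℂ (h i) (A x (h j)) : ℂ) * ψ i j x := by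
  classical
  have : CompleteSpace X := FiniteDimensional.complete ℂ X
  have hU : ∀ a : Fin m, ∃ U : unitary (X →L[ℂ] X), ∀ i s, FreeGroup.norm s ≤ d →
      FreeGroup.norm (FreeGroup.of a * s) ≤ d →
      (U : X →L[ℂ] X) (v i s) = v i (FreeGroup.of a * s) := by
    intro a
    have hfin : {s : FreeGroup (Fin m) | FreeGroup.norm s ≤ d ∧
        FreeGroup.norm (FreeGroup.of a * s) ≤ d}.Finite :=
      (ball_finite m d).subset fun s hs => hs.1
    have := hfin.fintype
    obtain ⟨U, hU⟩ := exists_unitary_of_gram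
      (J := Fin k × {s : FreeGroup (Fin m) | FreeGroup.norm s ≤ d ∧
        FreeGroup.norm (FreeGroup.of a * s) ≤ d})
      (fun p => v p.1 p.2) (fun p => v p.1 (FreeGroup.of a * p.2)) (by
        rintro ⟨i, s, hs⟩ ⟨j, t, ht⟩
        simp only
        rw [hv _ _ _ _ hs.1 ht.1, hv _ _ _ _ hs.2 ht.2]
        congr 1; group)
    exact ⟨U, fun i s h1 h2 => hU (i, ⟨s, h1, h2⟩)⟩
  choose U hU using hU
  have := hpos ⟨X⟩ U k h (fun i => v i 1)
  convert this using 8 with i _ j _ x hx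
  have hx' : FreeGroup.norm x ≤ d := by
    by_contra hc
    exact (Finsupp.mem_support_iff.1 hx) (hdeg x (not_le.1 hc))
  rw [word_orbit (d := d) (v j) U (fun a s h1 h2 => hU a j s h1 h2) x hx', hv _ _ _ _ (by simp) hx']
  simp

theorem coeff_herm {m d : ℕ}
    {C : Type*} [NormedAddCommGroup C] [InnerProductSpace ℂ C] [CompleteSpace C]
    (A : FreeGroup (Fin m) →₀ (C →L[ℂ] C))
    (hdeg : ∀ x : FreeGroup (Fin m), d < FreeGroup.norm x → A x = 0)
    (hpos : IsPos A) (x : FreeGroup (Fin m)) :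
    A x⁻¹ = ContinuousLinearMap.adjoint (A x) := by
  classical
  have key : ∀ (c : C) (z : ℂ), 0 ≤ (1 + z * star z) * inner ℂ c (A 1 c) +
      z * inner ℂ c (A x c) + star z * inner ℂ c (A x⁻¹ c) := by
    intro c z
    have := (ball_finite m (d + FreeGroup.norm x)).fintype
    let κ := {s : FreeGroup (Fin m) | FreeGroup.norm s ≤ d + FreeGroup.norm x}
    let e : FreeGroup (Fin m) → EuclideanSpace ℂ κ := fun s =>
      if hs : s ∈ κ then EuclideanSpace.single ⟨s, hs⟩ 1 else 0
    have he : ∀ s t, s ∈ κ → t ∈ κ → inner ℂ (e s) (e t) = if s = t then (1 : ℂ) else 0 := by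
      intro s t hs ht
      simp only [e, dif_pos hs, dif_pos ht]
      rw [EuclideanSpace.inner_single_left]
      simp [Pi.single_apply]
    have hA := pos_pairing (d := d) A hdeg hpos (k := 1) (fun _ => c)
      (fun _ _ y => (if y = 1 then (1 + z * star z) else 0) + (if y = x then z else 0) +
        (if y = x⁻¹ then star z else 0))
      (fun _ s => e s + star z • e (s * x)) (by
        intro i j s t hs ht
        have h1 : s ∈ κ := by simp only [κ, Set.mem_ofPred_eq]; omega
        have h2 : t ∈ κ := by simp only [κ, Set.mem_ofPred_eq]; omega
        have h3 : s * x ∈ κ := by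
          have := FreeGroup.norm_mul_le s x
          simp only [κ, Set.mem_ofPred_eq]; omega
        have h4 : t * x ∈ κ := by
          have := FreeGroup.norm_mul_le t x
          simp only [κ, Set.mem_ofPred_eq]; omega
        simp only [inner_add_left, inner_add_right, inner_smul_left, inner_smul_right,
          he _ _ h1 h2, he _ _ h1 h4, he _ _ h3 h2, he _ _ h3 h4]
        have e1 : (s⁻¹ * t = 1) ↔ s = t := by rw [inv_mul_eq_one]
        have e2 : (s⁻¹ * t = x) ↔ s * x = t := by rw [inv_mul_eq_iff_eq_mul, eq_comm]
        have e3 : (s⁻¹ * t = x⁻¹) ↔ s = t * x := by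
          rw [inv_mul_eq_iff_eq_mul, eq_mul_inv_iff_mul_eq, eq_comm]
        simp only [e1, e2, e3, mul_left_inj]
        split_ifs <;> simp <;> ring)
    have hsum : ∀ (y : FreeGroup (Fin m)) (w : ℂ), ∑ q ∈ A.support,
        inner ℂ c (A q c) * (if q = y then w else 0) = w * inner ℂ c (A y c) := by
      intro y w
      simp only [mul_ite, mul_zero, Finset.sum_ite_eq']
      split_ifs with hy
      · ring
      · rw [Finsupp.notMem_support_iff.1 hy]; simp
    simp only [Finset.univ_unique, Finset.sum_singleton, mul_add, Finset.sum_add_distrib] at hA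
    simp only [hsum] at hA
    convert hA using 2
  have key2 : ∀ c : C, inner ℂ c (A x⁻¹ c) = inner ℂ c (ContinuousLinearMap.adjoint (A x) c) := by
    intro c
    rw [ContinuousLinearMap.adjoint_inner_right, ← inner_conj_symm (A x c) c]
    have k0 := (Complex.le_def.1 (key c 0)).2
    have k1 := (Complex.le_def.1 (key c 1)).2
    have k2 := (Complex.le_def.1 (key c Complex.I)).2
    simp at k0 k1 k2
    apply Complex.ext
    · rw [Complex.conj_re]; linarith
    · rw [Complex.conj_im]; linarith
  rw [← sub_eq_zero]
  have h0 : ((A x⁻¹ - ContinuousLinearMap.adjoint (A x) : C →L[ℂ] C) : C →ₗ[ℂ] C) = 0 := by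
    rw [← inner_map_self_eq_zero]
    intro c
    have := key2 c
    rw [← inner_conj_symm]
    simp [inner_sub_right, this]
  ext c
  exact LinearMap.congr_fun h0 c

open scoped MatrixOrder in
theorem exists_factor {ι : Type} [Fintype ι] [DecidableEq ι] {M : Matrix ι ι ℂ}
    (h : M.PosSemidef) : ∃ V : Matrix ι ι ℂ, M = V.conjTranspose * V :=
  CStarAlgebra.nonneg_iff_eq_star_mul_self.1 h.nonneg

theorem gram_of_posSemidef {ι : Type} [Fintype ι] [DecidableEq ι] {M : Matrix ι ι ℂ}
    (h : M.PosSemidef) : ∃ v : ι → EuclideanSpace ℂ ι, ∀ p q, inner ℂ (v p) (v q) = M p q := by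
  obtain ⟨V, rfl⟩ := exists_factor h
  refine ⟨fun p => WithLp.toLp 2 (fun r => V r p), fun p q => ?_⟩
  simp [PiLp.inner_apply, Matrix.mul_apply, mul_comm]

theorem compact_psd {ι : Type} [Fintype ι] [DecidableEq ι] (R : ℝ) :
    IsCompact {T : Matrix ι ι ℂ | T.PosSemidef ∧ T.trace.re ≤ R} := by
  let g : EuclideanSpace ℂ (ι × ι) → Matrix ι ι ℂ := fun x =>
    (Matrix.of fun a b => x (a, b)).conjTranspose * (Matrix.of fun a b => x (a, b))
  have htr : ∀ x, (g x).trace.re = ‖x‖ ^ 2 := by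
    intro x
    rw [EuclideanSpace.norm_sq_eq, Fintype.sum_prod_type, Finset.sum_comm]
    simp only [g, Matrix.trace, Matrix.diag, Matrix.mul_apply, Complex.re_sum]
    refine Finset.sum_congr rfl fun a _ => Finset.sum_congr rfl fun b _ => ?_
    simp [Complex.sq_norm, Complex.normSq_apply]
  have hg : Continuous g := by
    refine continuous_matrix fun a b => ?_
    simp only [g, Matrix.mul_apply, Matrix.conjTranspose_apply, Matrix.of_apply]
    fun_prop
  have hc : IsCompact {x : EuclideanSpace ℂ (ι × ι) | ‖x‖ ^ 2 ≤ R} := by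
    refine Metric.isCompact_of_isClosed_isBounded ?_ ?_
    · exact isClosed_le (by fun_prop) continuous_const
    · refine (Metric.isBounded_closedBall (x := 0) (r := Real.sqrt R)).subset ?_
      intro x hx
      simp only [Metric.mem_closedBall, dist_zero_right]
      exact Real.le_sqrt_of_sq_le hx
  convert hc.image hg
  ext T
  constructor
  · rintro ⟨h1, h2⟩
    obtain ⟨V, rfl⟩ := exists_factor h1
    have : g (WithLp.toLp 2 (fun p => V p.1 p.2)) = V.conjTranspose * V := rfl
    refine ⟨WithLp.toLp 2 (fun p => V p.1 p.2), ?_, this⟩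
    show _ ≤ R
    rw [← htr, this]; exact h2
  · rintro ⟨x, hx, rfl⟩
    refine ⟨Matrix.posSemidef_conjTranspose_mul_self _, ?_⟩
    rw [htr]; exact hx

/-- The map collapsing a block matrix along the fibres of `(s, t) ↦ s⁻¹ * t`. -/
noncomputable def collapse {G : Type} [Group G] [DecidableEq G] (S : Finset G) (k : ℕ) :
    Matrix (Fin k × S) (Fin k × S) ℂ →ₗ[ℂ] (G → Fin k → Fin k → ℂ) where
  toFun T := fun x i j => ∑ s : S, ∑ t : S,
    if (s : G)⁻¹ * (t : G) = x then T (i, s) (j, t) else 0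
  map_add' T T' := by
    ext x i j
    simp only [Pi.add_apply, ← Finset.sum_add_distrib]
    refine Finset.sum_congr rfl fun a _ => Finset.sum_congr rfl fun b _ => ?_
    split_ifs <;> simp
  map_smul' c T := by
    ext x i j
    simp only [Pi.smul_apply, Finset.smul_sum, RingHom.id_apply]
    refine Finset.sum_congr rfl fun a _ => Finset.sum_congr rfl fun b _ => ?_
    split_ifs <;> simp

theorem collapse_apply {G : Type} [Group G] [DecidableEq G] (S : Finset G) (k : ℕ)
    (T : Matrix (Fin k × S) (Fin k × S) ℂ) (x : G) (i j : Fin k) :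
    collapse S k T x i j = ∑ s : S, ∑ t : S,
      if (s : G)⁻¹ * (t : G) = x then T (i, s) (j, t) else 0 := rfl

theorem collapse_continuous {G : Type} [Group G] [DecidableEq G] (S : Finset G) (k : ℕ) :
    Continuous (collapse S k) := by
  refine continuous_pi fun x => continuous_pi fun i => continuous_pi fun j => ?_
  simp only [collapse_apply]
  refine continuous_finsetSum _ fun s _ => continuous_finsetSum _ fun t _ => ?_
  split_ifs
  · exact continuous_id.matrix_elem _ _
  · exact continuous_const

/-- Basis elements. -/
noncomputable def sgl {G : Type} [DecidableEq G] {k : ℕ} (x : G) (i j : Fin k) :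
    G → Fin k → Fin k → ℂ := Pi.single x (Pi.single i (Pi.single j 1))

theorem sgl_apply {G : Type} [DecidableEq G] {k : ℕ} (x : G) (i j : Fin k) (y : G)
    (i' j' : Fin k) : sgl x i j y i' j' = if x = y ∧ i = i' ∧ j = j' then 1 else 0 := by
  unfold sgl
  by_cases h1 : x = y
  · subst h1
    by_cases h2 : i = i'
    · subst h2
      by_cases h3 : j = j'
      · subst h3; simp
      · simp [h3, Pi.single_apply, eq_comm]
    · simp [h2, Ne.symm h2]
  · simp [h1, Ne.symm h1]

theorem collapse_eq_sum {G : Type} [Group G] [DecidableEq G] (S : Finset G) (k : ℕ)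
    (T : Matrix (Fin k × S) (Fin k × S) ℂ) :
    collapse S k T = ∑ p, ∑ q, T p q • sgl ((p.2 : G)⁻¹ * (q.2 : G)) p.1 q.1 := by
  ext x i j
  rw [collapse_apply]
  simp only [Finset.sum_apply, Pi.smul_apply, sgl_apply, Fintype.sum_prod_type, smul_eq_mul]
  rw [Finset.sum_eq_single i (fun b _ hb => by simp [hb]) (by simp)]
  refine Finset.sum_congr rfl fun s _ => ?_
  rw [Finset.sum_eq_single j (fun b _ hb => by simp [hb]) (by simp)]
  refine Finset.sum_congr rfl fun t _ => ?_
  simp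

theorem eq_sum_sgl {G : Type} [DecidableEq G] {k : ℕ} (S : Finset G)
    (a : G → Fin k → Fin k → ℂ) (ha : ∀ x ∉ S, a x = 0) :
    a = ∑ i, ∑ j, ∑ x ∈ S, a x i j • sgl x i j := by
  ext y i' j'
  simp only [Finset.sum_apply, Pi.smul_apply, sgl_apply, smul_eq_mul]
  rw [Finset.sum_eq_single i' (fun b _ hb => by simp [hb]) (by simp)]
  rw [Finset.sum_eq_single j' (fun b _ hb => by simp [hb]) (by simp)]
  by_cases hy : y ∈ S
  · rw [Finset.sum_eq_single y (fun b _ hb => by simp [hb]) (by simp [hy])]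
    simp
  · rw [Finset.sum_eq_zero]
    · simp [ha y hy]
    · intro x hx
      have : x ≠ y := fun h => hy (h ▸ hx)
      simp [this]

/-- Separation step: a functional that is nonnegative on collapsed positive matrices. -/
theorem exists_separating {G : Type} [Group G] [DecidableEq G] (S : Finset G) (k : ℕ)
    (a : G → Fin k → Fin k → ℂ) (ha : ∀ x ∉ S, a x = 0) (h1 : (1 : G) ∈ S)
    (hno : ¬ ∃ T : Matrix (Fin k × S) (Fin k × S) ℂ, T.PosSemidef ∧ collapse S k T = a) :
    ∃ φ : Fin k → Fin k → G → ℂ,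
      (∀ c : Fin k × S → ℂ, 0 ≤ (∑ p, ∑ q, star (c p) * c q *
        φ p.1 q.1 ((p.2 : G)⁻¹ * (q.2 : G))).re) ∧
      (∑ i, ∑ j, ∑ x ∈ S, a x i j * φ i j x).re < 0 := by
  classical
  set τ : ℝ := (∑ i, a 1 i i).re with hτ
  set R : ℝ := |τ| + 1 with hR
  have hRpos : 0 < R := by positivity
  let P := {T : Matrix (Fin k × S) (Fin k × S) ℂ | T.PosSemidef ∧ T.trace.re ≤ R}
  have hPc : IsCompact P := compact_psd R
  have hconv : Convex ℝ P := by
    intro T hT T' hT' α β hα hβ hαβ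
    refine ⟨(hT.1.smul hα).add (hT'.1.smul hβ), ?_⟩
    have h2 := hT.2
    have h3 := hT'.2
    simp only [Matrix.trace_add, Matrix.trace_smul, Complex.add_re, Complex.real_smul,
      Complex.re_ofReal_mul]
    calc α * T.trace.re + β * T'.trace.re ≤ α * R + β * R := by gcongr
      _ = R := by rw [← add_mul, hαβ, one_mul]
  have hKc : IsCompact (collapse S k '' P) := hPc.image (collapse_continuous S k)
  have hKconv : Convex ℝ (collapse S k '' P) :=
    hconv.linear_image ((collapse S k).restrictScalars ℝ)
  have hnot : a ∉ collapse S k '' P := by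
    rintro ⟨T, hT, hTa⟩
    exact hno ⟨T, hT.1, hTa⟩
  obtain ⟨f, u, hf, hu⟩ := RCLike.geometric_hahn_banach_closed_point (𝕜 := ℂ) hKconv
    hKc.isClosed hnot
  have hu0 : 0 < u := by
    have := hf 0 ⟨0, ⟨Matrix.PosSemidef.zero, by simpa using hRpos.le⟩, map_zero _⟩
    simpa using this
  simp only [RCLike.re_eq_complex_re] at hf hu
  refine ⟨fun i j x => (if x = 1 ∧ i = j then ((u / R : ℝ) : ℂ) else 0) - f (sgl x i j), ?_, ?_⟩
  · intro c
    set T : Matrix (Fin k × S) (Fin k × S) ℂ := Matrix.vecMulVec (star c) c with hTdef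
    have hT : T.PosSemidef := Matrix.posSemidef_vecMulVec_star_self c
    have hfT : f (collapse S k T) = ∑ p, ∑ q, star (c p) * c q *
        f (sgl ((p.2 : G)⁻¹ * (q.2 : G)) p.1 q.1) := by
      rw [collapse_eq_sum]
      simp [map_sum, hTdef, Matrix.vecMulVec_apply]
    have htr : T.trace = ∑ p, ∑ q, star (c p) * c q *
        (if (p.2 : G)⁻¹ * (q.2 : G) = 1 ∧ p.1 = q.1 then (1 : ℂ) else 0) := by
      simp only [Matrix.trace, Matrix.diag, hTdef, Matrix.vecMulVec_apply]
      refine Finset.sum_congr rfl fun p _ => ?_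
      rw [Finset.sum_eq_single p]
      · simp
      · intro q _ hq
        rw [if_neg, mul_zero]
        rintro ⟨e1, e2⟩
        rw [inv_mul_eq_one] at e1
        exact hq (Prod.ext e2.symm (Subtype.ext e1.symm))
      · simp
    have hsplit : (∑ p, ∑ q, star (c p) * c q *
        ((if (p.2 : G)⁻¹ * (q.2 : G) = 1 ∧ p.1 = q.1 then ((u / R : ℝ) : ℂ) else 0) -
          f (sgl ((p.2 : G)⁻¹ * (q.2 : G)) p.1 q.1))) =
        ((u / R : ℝ) : ℂ) * T.trace - f (collapse S k T) := by
      rw [hfT, htr, Finset.mul_sum, ← Finset.sum_sub_distrib]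
      refine Finset.sum_congr rfl fun p _ => ?_
      rw [Finset.mul_sum, ← Finset.sum_sub_distrib]
      refine Finset.sum_congr rfl fun q _ => ?_
      split_ifs <;> ring
    rw [hsplit, Complex.sub_re, Complex.re_ofReal_mul]
    have hr0 : 0 ≤ T.trace.re := (Complex.le_def.1 hT.trace_nonneg).1
    rcases hr0.eq_or_lt with hr | hr
    · have hT0 : T = 0 := by
        rw [← hT.trace_eq_zero_iff]
        apply Complex.ext
        · exact hr.symm
        · exact (Complex.le_def.1 hT.trace_nonneg).2.symm
      rw [hT0]; simp
    · have := hf (collapse S k ((R / T.trace.re : ℝ) • T)) ⟨_, ⟨hT.smul (by positivity), by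
        simp only [Matrix.trace_smul, Complex.real_smul, Complex.re_ofReal_mul]
        rw [div_mul_cancel₀ _ hr.ne']⟩, rfl⟩
      have e : f (collapse S k ((R / T.trace.re : ℝ) • T)) =
          ((R / T.trace.re : ℝ) : ℂ) * f (collapse S k T) := by
        rw [← Complex.coe_smul, map_smul, map_smul, smul_eq_mul]
      rw [e, Complex.re_ofReal_mul] at this
      have h5 : (f (collapse S k T)).re < u * T.trace.re / R := by
        rw [lt_div_iff₀ hRpos]
        rw [div_mul_eq_mul_div, div_lt_iff₀ hr] at this
        linarith
      have h6 : u / R * T.trace.re = u * T.trace.re / R := by ring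
      linarith
  · have hfa : f a = ∑ i, ∑ j, ∑ x ∈ S, a x i j * f (sgl x i j) := by
      conv_lhs => rw [eq_sum_sgl S a ha]
      simp [map_sum]
    have hsplit : (∑ i, ∑ j, ∑ x ∈ S, a x i j *
        ((if x = 1 ∧ i = j then ((u / R : ℝ) : ℂ) else 0) - f (sgl x i j))) =
        ((u / R : ℝ) : ℂ) * (∑ i, a 1 i i) - f a := by
      rw [hfa, Finset.mul_sum, ← Finset.sum_sub_distrib]
      refine Finset.sum_congr rfl fun i _ => ?_
      simp only [mul_sub, Finset.sum_sub_distrib]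
      congr 1
      rw [Finset.sum_eq_single i, Finset.sum_eq_single 1]
      · simp [mul_comm]
      · intro x _ hx; simp [hx]
      · intro hx; exact absurd h1 hx
      · intro j _ hj
        refine Finset.sum_eq_zero fun x _ => ?_
        simp [hj.symm]
      · simp
    rw [hsplit, Complex.sub_re, Complex.re_ofReal_mul, ← hτ]
    have h7 : u / R * τ ≤ u := by
      rw [div_mul_eq_mul_div, div_le_iff₀ hRpos]
      have : τ ≤ R := by have := le_abs_self τ; linarith
      exact mul_le_mul_of_nonneg_left this hu0.le
    linarith

theorem fd_exists {m d : ℕ}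
    {C : Type*} [NormedAddCommGroup C] [InnerProductSpace ℂ C] [CompleteSpace C]
    (A : FreeGroup (Fin m) →₀ (C →L[ℂ] C))
    (hdeg : ∀ x : FreeGroup (Fin m), d < FreeGroup.norm x → A x = 0)
    (hpos : IsPos A) (S : Finset (FreeGroup (Fin m)))
    (hS : ∀ s, s ∈ S ↔ FreeGroup.norm s ≤ d) {k : ℕ} (h : Fin k → C) :
    ∃ w : Fin k → S → EuclideanSpace ℂ (Fin k × S), ∀ x i j,
      (∑ s : S, ∑ t : S, if (s : FreeGroup (Fin m))⁻¹ * (t : FreeGroup (Fin m)) = x then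
        (inner ℂ (w i s) (w j t) : ℂ) else 0) = inner ℂ (h i) (A x (h j)) := by
  classical
  set a : FreeGroup (Fin m) → Fin k → Fin k → ℂ := fun x i j => inner ℂ (h i) (A x (h j)) with had
  have hzero : ∀ x ∉ S, A x = 0 := fun x hx => hdeg x (not_le.1 fun hc => hx ((hS x).2 hc))
  have ha : ∀ x ∉ S, a x = 0 := by
    intro x hx
    ext i j
    simp [had, hzero x hx]
  have h1 : (1 : FreeGroup (Fin m)) ∈ S := by rw [hS]; simp
  have hsupp : A.support ⊆ S := by
    intro x hx
    by_contra hc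
    exact Finsupp.mem_support_iff.1 hx (hzero x hc)
  have haherm : ∀ x i j, a x⁻¹ j i = star (a x i j) := by
    intro x i j
    simp only [had]
    rw [coeff_herm A hdeg hpos x, ContinuousLinearMap.adjoint_inner_right]
    exact (inner_conj_symm _ _).symm
  obtain ⟨T, hT, hTa⟩ : ∃ T : Matrix (Fin k × S) (Fin k × S) ℂ,
      T.PosSemidef ∧ collapse S k T = a := by
    by_contra hno
    obtain ⟨φ, hφ, hneg⟩ := exists_separating S k a ha h1 hno
    let ψ : Fin k → Fin k → FreeGroup (Fin m) → ℂ := fun i j x => φ i j x + star (φ j i x⁻¹)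
    let M : Matrix (Fin k × S) (Fin k × S) ℂ := Matrix.of fun p q =>
      ψ p.1 q.1 ((p.2 : FreeGroup (Fin m))⁻¹ * (q.2 : FreeGroup (Fin m)))
    have hM : M.PosSemidef := by
      refine Matrix.PosSemidef.of_dotProduct_mulVec_nonneg ?_ ?_
      · ext p q
        simp [M, ψ, add_comm]
      · intro c
        set Z := ∑ p, ∑ q, star (c p) * c q *
          φ p.1 q.1 ((p.2 : FreeGroup (Fin m))⁻¹ * (q.2 : FreeGroup (Fin m))) with hZ
        have e : star c ⬝ᵥ M.mulVec c = Z + star Z := by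
          have e2 : star Z = ∑ p, ∑ q, star (c p) * c q *
            star (φ q.1 p.1 ((q.2 : FreeGroup (Fin m))⁻¹ * (p.2 : FreeGroup (Fin m)))) := by
            rw [hZ, Finset.sum_comm, star_sum]
            refine Finset.sum_congr rfl fun p _ => ?_
            rw [star_sum]
            refine Finset.sum_congr rfl fun q _ => ?_
            simp only [star_mul', star_star]; ring
          rw [e2, hZ, ← Finset.sum_add_distrib]
          simp only [dotProduct, Matrix.mulVec, Finset.mul_sum]
          refine Finset.sum_congr rfl fun p _ => ?_
          rw [← Finset.sum_add_distrib]
          refine Finset.sum_congr rfl fun q _ => ?_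
          simp [M, ψ]; ring
        rw [e, Complex.le_def]
        have := hφ c
        constructor
        · simp only [Complex.zero_re, Complex.add_re, Complex.star_def, Complex.conj_re]
          linarith
        · simp
    obtain ⟨v, hv⟩ := gram_of_posSemidef hM
    have hp := pos_pairing (d := d) A hdeg hpos h ψ
      (fun i s => if hs : s ∈ S then v (i, ⟨s, hs⟩) else 0) (by
        intro i j s t hs ht
        rw [← hS] at hs ht
        simp only [dif_pos hs, dif_pos ht, hv]
        rfl)
    have hp2 : (∑ i, ∑ j, ∑ x ∈ A.support, (inner ℂ (h i) (A x (h j)) : ℂ) * ψ i j x) =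
        ∑ i, ∑ j, ∑ x ∈ S, a x i j * ψ i j x := by
      refine Finset.sum_congr rfl fun i _ => Finset.sum_congr rfl fun j _ => ?_
      refine Finset.sum_subset hsupp fun x _ hx => ?_
      rw [Finsupp.notMem_support_iff.1 hx]; simp
    rw [hp2] at hp
    set Y := ∑ i, ∑ j, ∑ x ∈ S, a x i j * φ i j x with hY
    have hstar : star Y = ∑ i, ∑ j, ∑ x ∈ S, a x i j * star (φ j i x⁻¹) := by
      rw [hY, Finset.sum_comm, star_sum]
      refine Finset.sum_congr rfl fun i _ => ?_
      rw [star_sum]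
      refine Finset.sum_congr rfl fun j _ => ?_
      rw [star_sum]
      refine Finset.sum_nbij' (fun x => x⁻¹) (fun x => x⁻¹) ?_ ?_ ?_ ?_ ?_
      · intro x hx; rw [hS] at hx ⊢; simpa using hx
      · intro x hx; rw [hS] at hx ⊢; simpa using hx
      · simp
      · simp
      · intro x _
        rw [haherm, inv_inv, star_mul']
    have hfin : (∑ i, ∑ j, ∑ x ∈ S, a x i j * ψ i j x) = Y + star Y := by
      rw [hstar, hY]
      simp only [ψ, mul_add, Finset.sum_add_distrib]
    rw [hfin] at hp
    have := (Complex.le_def.1 hp).1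
    simp only [Complex.zero_re, Complex.add_re, Complex.star_def, Complex.conj_re] at this
    linarith
  obtain ⟨v, hv⟩ := gram_of_posSemidef hT
  refine ⟨fun i s => v (i, s), fun x i j => ?_⟩
  have := congrFun (congrFun (congrFun hTa x) i) j
  rw [collapse_apply] at this
  simp only [hv]
  exact this

theorem swap4 {I J : Type*} [Fintype I] [Fintype J] (f : J → J → I → I → ℂ) :
    ∑ s, ∑ t, ∑ i, ∑ j, f s t i j = ∑ i, ∑ j, ∑ s, ∑ t, f s t i j := by
  have := Finset.sum_comm (s := (Finset.univ : Finset (J × J)))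
    (t := (Finset.univ : Finset (I × I))) (f := fun p q => f p.1 p.2 q.1 q.2)
  simpa only [Fintype.sum_prod_type] using this

theorem compress {m d : ℕ}
    {C : Type*} [NormedAddCommGroup C] [InnerProductSpace ℂ C] [CompleteSpace C]
    (A : FreeGroup (Fin m) →₀ (C →L[ℂ] C))
    (hdeg : ∀ x : FreeGroup (Fin m), d < FreeGroup.norm x → A x = 0)
    (hpos : IsPos A) (S : Finset (FreeGroup (Fin m)))
    (hS : ∀ s, s ∈ S ↔ FreeGroup.norm s ≤ d) (E : Submodule ℂ C) [FiniteDimensional ℂ E] :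
    ∃ (k : ℕ) (Y : S → C →ₗ[ℂ] EuclideanSpace ℂ (Fin k × S)), ∀ x h h',
      (∑ s : S, ∑ t : S, if (s : FreeGroup (Fin m))⁻¹ * (t : FreeGroup (Fin m)) = x then
        (inner ℂ (Y s h) (Y t h') : ℂ) else 0) =
        inner ℂ (E.starProjection h) (A x (E.starProjection h')) := by
  let b := stdOrthonormalBasis ℂ E
  obtain ⟨w, hw⟩ := fd_exists A hdeg hpos S hS (fun i => (b i : C))
  refine ⟨Module.finrank ℂ E, fun s => ∑ i, (innerSL ℂ (b i : C)).toLinearMap.smulRight (w i s),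
    fun x h h' => ?_⟩
  have hP : ∀ h : C, E.starProjection h = ∑ i, (inner ℂ (b i : C) h : ℂ) • (b i : C) := by
    intro h
    rw [Submodule.starProjection_apply, b.orthogonalProjectionOnto_apply_eq_sum]
    simp
  rw [hP, hP]
  have e : ∀ s t : S, (if (s : FreeGroup (Fin m))⁻¹ * (t : FreeGroup (Fin m)) = x then
      (inner ℂ ((∑ i, (innerSL ℂ (b i : C)).toLinearMap.smulRight (w i s)) h)
        ((∑ i, (innerSL ℂ (b i : C)).toLinearMap.smulRight (w i t)) h') : ℂ) else 0) =
      ∑ i, ∑ j, starRingEnd ℂ (inner ℂ (b i : C) h) * inner ℂ (b j : C) h' *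
        (if (s : FreeGroup (Fin m))⁻¹ * (t : FreeGroup (Fin m)) = x then
          (inner ℂ (w i s) (w j t) : ℂ) else 0) := by
    intro s t
    split_ifs
    · simp only [LinearMap.sum_apply, LinearMap.smulRight_apply, ContinuousLinearMap.coe_coe,
        innerSL_apply_apply, sum_inner]
      refine Finset.sum_congr rfl fun i _ => ?_
      rw [inner_sum]
      refine Finset.sum_congr rfl fun j _ => ?_
      rw [inner_smul_left, inner_smul_right]; ring
    · simp
  have e' : (inner ℂ (∑ i, (inner ℂ (b i : C) h : ℂ) • (b i : C))
      (A x (∑ i, (inner ℂ (b i : C) h' : ℂ) • (b i : C))) : ℂ) =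
      ∑ i, ∑ j, ∑ s : S, ∑ t : S, starRingEnd ℂ (inner ℂ (b i : C) h) * inner ℂ (b j : C) h' *
        (if (s : FreeGroup (Fin m))⁻¹ * (t : FreeGroup (Fin m)) = x then
          (inner ℂ (w i s) (w j t) : ℂ) else 0) := by
    rw [map_sum, sum_inner]
    refine Finset.sum_congr rfl fun i _ => ?_
    rw [inner_sum]
    refine Finset.sum_congr rfl fun j _ => ?_
    rw [map_smul, inner_smul_left, inner_smul_right, ← hw]
    simp only [← Finset.mul_sum]
    ring
  rw [e']
  simp only [e]
  exact swap4 _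

theorem exists_form {m d : ℕ}
    {C : Type*} [NormedAddCommGroup C] [InnerProductSpace ℂ C] [CompleteSpace C]
    (A : FreeGroup (Fin m) →₀ (C →L[ℂ] C))
    (hdeg : ∀ x : FreeGroup (Fin m), d < FreeGroup.norm x → A x = 0)
    (hpos : IsPos A) (S : Finset (FreeGroup (Fin m)))
    (hS : ∀ s, s ∈ S ↔ FreeGroup.norm s ≤ d) :
    ∃ (β : S → S → C → C → ℂ),
      (∀ s t h h' h'', β s t (h + h') h'' = β s t h h'' + β s t h' h'') ∧
      (∀ s t (c : ℂ) h h', β s t (c • h) h' = star c * β s t h h') ∧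
      (∀ s t h h' h'', β s t h (h' + h'') = β s t h h' + β s t h h'') ∧
      (∀ s t (c : ℂ) h h', β s t h (c • h') = c * β s t h h') ∧
      (∀ s t h h', ‖β s t h h'‖ ≤ ‖A 1‖ * ‖h‖ * ‖h'‖) ∧
      (∀ c : S → C, 0 ≤ ∑ s, ∑ t, β s t (c s) (c t)) ∧
      (∀ x h h', (∑ s : S, ∑ t : S,
        if (s : FreeGroup (Fin m))⁻¹ * (t : FreeGroup (Fin m)) = x then β s t h h' else 0) =
        inner ℂ h (A x h')) := by
  classical
  have hY : ∀ F : Finset C, _ := fun F =>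
    compress A hdeg hpos S hS (Submodule.span ℂ (F : Set C))
  choose k Y hY using hY
  let g : Finset C → S → S → C → C → ℂ := fun F s t h h' => inner ℂ (Y F s h) (Y F t h')
  have hbd1 : ∀ F s h, ‖Y F s h‖ ^ 2 ≤ ‖A 1‖ * ‖h‖ ^ 2 := by
    intro F s h
    have h0 := hY F 1 h h
    have h1 : (∑ s : S, ∑ t : S,
        if (s : FreeGroup (Fin m))⁻¹ * (t : FreeGroup (Fin m)) = 1 then
        (inner ℂ (Y F s h) (Y F t h) : ℂ) else 0) = ((∑ s : S, ‖Y F s h‖ ^ 2 : ℝ) : ℂ) := by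
      push_cast
      refine Finset.sum_congr rfl fun s _ => ?_
      rw [Finset.sum_eq_single s]
      · simp [inner_self_eq_norm_sq_to_K]
      · intro t _ ht
        rw [if_neg]
        rw [inv_mul_eq_one]
        exact fun e => ht (Subtype.ext e.symm)
      · simp
    rw [h1] at h0
    have h2 := congrArg norm h0
    rw [Complex.norm_real, Real.norm_of_nonneg (by positivity)] at h2
    set P := (Submodule.span ℂ (F : Set C)).starProjection
    have hPn : ‖P h‖ ≤ ‖h‖ := Submodule.norm_starProjection_apply_le _ h
    calc ‖Y F s h‖ ^ 2 ≤ ∑ s : S, ‖Y F s h‖ ^ 2 :=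
          Finset.single_le_sum (f := fun s => ‖Y F s h‖ ^ 2) (fun _ _ => by positivity)
            (Finset.mem_univ s)
      _ = ‖inner ℂ (P h) (A 1 (P h))‖ := h2
      _ ≤ ‖P h‖ * ‖A 1 (P h)‖ := norm_inner_le_norm _ _
      _ ≤ ‖P h‖ * (‖A 1‖ * ‖P h‖) := by gcongr; exact (A 1).le_opNorm _
      _ ≤ ‖h‖ * (‖A 1‖ * ‖h‖) := by gcongr
      _ = ‖A 1‖ * ‖h‖ ^ 2 := by ring
  have hbd : ∀ F s t h h', ‖g F s t h h'‖ ≤ ‖A 1‖ * ‖h‖ * ‖h'‖ := by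
    intro F s t h h'
    have h1 : ‖g F s t h h'‖ ≤ ‖Y F s h‖ * ‖Y F t h'‖ := norm_inner_le_norm _ _
    refine h1.trans ?_
    refine abs_le_of_sq_le_sq' ?_ (by positivity) |>.2
    calc (‖Y F s h‖ * ‖Y F t h'‖) ^ 2 = ‖Y F s h‖ ^ 2 * ‖Y F t h'‖ ^ 2 := by ring
      _ ≤ (‖A 1‖ * ‖h‖ ^ 2) * (‖A 1‖ * ‖h'‖ ^ 2) := by gcongr <;> apply hbd1
      _ = _ := by ring
  let 𝒰 : Ultrafilter (Finset C) := Ultrafilter.of Filter.atTop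
  have h𝒰 : (𝒰 : Filter (Finset C)) ≤ Filter.atTop := Ultrafilter.of_le _
  have hlim : ∀ s t h h', ∃ z : ℂ, Filter.Tendsto (fun F => g F s t h h') 𝒰 (nhds z) := by
    intro s t h h'
    obtain ⟨z, -, hz⟩ := (isCompact_closedBall (0 : ℂ) (‖A 1‖ * ‖h‖ * ‖h'‖)).ultrafilter_le_nhds
      (𝒰.map (fun F => g F s t h h')) (by
        rw [Filter.le_principal_iff]
        exact Filter.mem_map.2 (Filter.univ_mem' fun F => by simpa using hbd F s t h h'))
    exact ⟨z, hz⟩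
  choose β hβ using hlim
  refine ⟨β, ?_, ?_, ?_, ?_, ?_, ?_, ?_⟩
  · intro s t h h' h''
    refine tendsto_nhds_unique (hβ s t (h + h') h'') (((hβ s t h h'').add (hβ s t h' h'')).congr ?_)
    intro F; simp [g, inner_add_left]
  · intro s t c h h'
    refine tendsto_nhds_unique (hβ s t (c • h) h') (((hβ s t h h').const_mul (star c)).congr ?_)
    intro F; simp [g, inner_smul_left, mul_comm]
  · intro s t h h' h''
    refine tendsto_nhds_unique (hβ s t h (h' + h'')) (((hβ s t h h').add (hβ s t h h'')).congr ?_)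
    intro F; simp [g, inner_add_right]
  · intro s t c h h'
    refine tendsto_nhds_unique (hβ s t h (c • h')) (((hβ s t h h').const_mul c).congr ?_)
    intro F; simp [g, inner_smul_right]
  · intro s t h h'
    exact le_of_tendsto (hβ s t h h').norm (Filter.Eventually.of_forall fun F => hbd F s t h h')
  · intro c
    have ht : Filter.Tendsto (fun F => ∑ s, ∑ t, g F s t (c s) (c t)) 𝒰
        (nhds (∑ s, ∑ t, β s t (c s) (c t))) :=
      tendsto_finsetSum _ fun s _ => tendsto_finsetSum _ fun t _ => hβ s t _ _
    refine ge_of_tendsto ht (Filter.Eventually.of_forall fun F => ?_)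
    have : ∑ s, ∑ t, g F s t (c s) (c t) =
        inner ℂ (∑ s, Y F s (c s)) (∑ s, Y F s (c s)) := by
      simp only [g, sum_inner, inner_sum]
      rw [Finset.sum_comm]
    rw [this, inner_self_eq_norm_sq_to_K]
    norm_cast
    positivity
  · intro x h h'
    have ht : Filter.Tendsto (fun F => ∑ s : S, ∑ t : S,
        if (s : FreeGroup (Fin m))⁻¹ * (t : FreeGroup (Fin m)) = x then g F s t h h' else 0) 𝒰
        (nhds (∑ s : S, ∑ t : S,
        if (s : FreeGroup (Fin m))⁻¹ * (t : FreeGroup (Fin m)) = x then β s t h h' else 0)) := by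
      refine tendsto_finsetSum _ fun s _ => tendsto_finsetSum _ fun t _ => ?_
      split_ifs
      · exact hβ s t _ _
      · exact tendsto_const_nhds
    refine tendsto_nhds_unique ht (tendsto_const_nhds.congr' ?_)
    have hev : ∀ᶠ F in (𝒰 : Filter (Finset C)), ({h, h'} : Finset C) ≤ F :=
      h𝒰 (Filter.eventually_ge_atTop _)
    filter_upwards [hev] with F hF
    have e1 : (Submodule.span ℂ (F : Set C)).starProjection h = h :=
      Submodule.starProjection_eq_self_iff.2 (Submodule.subset_span (hF (by simp)))
    have e2 : (Submodule.span ℂ (F : Set C)).starProjection h' = h' :=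
      Submodule.starProjection_eq_self_iff.2 (Submodule.subset_span (hF (by simp)))
    have := hY F x h h'
    rw [e1, e2] at this
    exact this.symm

set_option synthInstance.maxHeartbeats 400000 in
theorem exists_star_mul {H : Type*} [NormedAddCommGroup H] [InnerProductSpace ℂ H]
    [CompleteSpace H] (M : H →L[ℂ] H) (h : 0 ≤ M) : ∃ R : H →L[ℂ] H, M = star R * R :=
  CStarAlgebra.nonneg_iff_eq_star_mul_self.1 h

theorem exists_blocks {C : Type*} [NormedAddCommGroup C] [InnerProductSpace ℂ C] [CompleteSpace C]
    {S : Type} [Fintype S] [DecidableEq S] (β : S → S → C → C → ℂ) (K : ℝ) (hK : 0 ≤ K)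
    (h1 : ∀ s t h h' h'', β s t (h + h') h'' = β s t h h'' + β s t h' h'')
    (h2 : ∀ s t (c : ℂ) h h', β s t (c • h) h' = star c * β s t h h')
    (h3 : ∀ s t h h' h'', β s t h (h' + h'') = β s t h h' + β s t h h'')
    (h4 : ∀ s t (c : ℂ) h h', β s t h (c • h') = c * β s t h h')
    (h5 : ∀ s t h h', ‖β s t h h'‖ ≤ K * ‖h‖ * ‖h'‖)
    (h6 : ∀ c : S → C, 0 ≤ ∑ s, ∑ t, β s t (c s) (c t)) :
    ∃ D : S → S → C →L[ℂ] C, ∀ s t h h', ∑ j, inner ℂ (D j s h) (D j t h') = β s t h h' := by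
  let f : (PiLp 2 (fun _ : S => C)) →ₗ⋆[ℂ] (PiLp 2 (fun _ : S => C)) →ₗ[ℂ] ℂ := LinearMap.mk₂'ₛₗ (starRingEnd ℂ) (RingHom.id ℂ)
    (fun u v => ∑ s, ∑ t, β s t (u s) (v t))
    (by intro u v w; simp [h1, Finset.sum_add_distrib])
    (by intro c u v; simp [h2, Finset.mul_sum])
    (by intro u v w; simp [h3, Finset.sum_add_distrib])
    (by intro c u v; simp [h4, Finset.mul_sum])
  let B : (PiLp 2 (fun _ : S => C)) →L⋆[ℂ] (PiLp 2 (fun _ : S => C)) →L[ℂ] ℂ := f.mkContinuous₂ (∑ _s : S, ∑ _t : S, K) (by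
    intro u v
    calc ‖∑ s, ∑ t, β s t (u s) (v t)‖ ≤ ∑ s, ∑ t, ‖β s t (u s) (v t)‖ :=
          (norm_sum_le _ _).trans (Finset.sum_le_sum fun s _ => norm_sum_le _ _)
      _ ≤ ∑ _s : S, ∑ _t : S, K * ‖u‖ * ‖v‖ := by
          refine Finset.sum_le_sum fun s _ => Finset.sum_le_sum fun t _ => (h5 s t _ _).trans ?_
          have e1 := PiLp.norm_apply_le u s
          have e2 := PiLp.norm_apply_le v t
          gcongr
      _ = (∑ _s : S, ∑ _t : S, K) * ‖u‖ * ‖v‖ := by simp only [Finset.sum_mul])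
  have hB : ∀ u v, B u v = ∑ s, ∑ t, β s t (u s) (v t) := fun u v => rfl
  let M : (PiLp 2 (fun _ : S => C)) →L[ℂ] (PiLp 2 (fun _ : S => C)) := InnerProductSpace.continuousLinearMapOfBilin B
  have hM : ∀ u v, inner ℂ (M u) v = B u v := InnerProductSpace.continuousLinearMapOfBilin_apply B
  have hM0 : 0 ≤ M := by
    rw [ContinuousLinearMap.nonneg_iff_isPositive, ContinuousLinearMap.isPositive_iff_complex]
    intro u
    have := Complex.le_def.1 (h6 (fun s => u s))
    rw [hM, hB]
    refine ⟨?_, this.1⟩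
    apply Complex.ext
    · simp
    · simpa using this.2
  obtain ⟨R, hR⟩ := exists_star_mul M hM0
  let ic : S → C →L[ℂ] (PiLp 2 (fun _ : S => C)) := fun s =>
    ((PiLp.continuousLinearEquiv 2 ℂ (fun _ : S => C)).symm : (S → C) →L[ℂ] (PiLp 2 (fun _ : S => C))).comp
      (ContinuousLinearMap.single ℂ (fun _ : S => C) s)
  have hic : ∀ s h t, ic s h t = if t = s then h else 0 := by
    intro s h t
    simp [ic, Pi.single_apply]
  refine ⟨fun j s => (PiLp.proj 2 (fun _ : S => C) j).comp (R.comp (ic s)), fun s t h h' => ?_⟩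
  have e1 : (∑ j, inner ℂ (((PiLp.proj (𝕜 := ℂ) 2 (fun _ : S => C) j).comp (R.comp (ic s))) h)
      (((PiLp.proj (𝕜 := ℂ) 2 (fun _ : S => C) j).comp (R.comp (ic t))) h') : ℂ) =
      inner ℂ (R (ic s h)) (R (ic t h')) := by
    rw [PiLp.inner_apply]; rfl
  rw [e1, ← ContinuousLinearMap.adjoint_inner_left]
  have e2 : (ContinuousLinearMap.adjoint R) (R (ic s h)) = M (ic s h) := by
    rw [hR]; rfl
  rw [e2, hM, hB]
  have z1 : ∀ s t h', β s t 0 h' = 0 := by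
    intro s t h'; have := h2 s t 0 0 h'; simpa using this
  have z2 : ∀ s t h, β s t h 0 = 0 := by
    intro s t h; have := h4 s t 0 h 0; simpa using this
  rw [Finset.sum_eq_single s, Finset.sum_eq_single t]
  · simp [hic]
  · intro b _ hb; rw [hic t]; simp [hb, z2]
  · simp
  · intro b _ hb; rw [Finset.sum_eq_zero]; intro q _; rw [hic s]; simp [hb, z1]
  · simp

end SOS

/-- A positive noncommutative polynomial `p(X) = Σ_{|x| ≤ d} A_x X(x)`
with operator coefficients is a finite sum of hermitian squares:
`p(X) = Σ_{j=1}^N Q_j(X)⋆ Q_j(X)` with polynomials `Q_j` with coefficients in `L(C)`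
supported on words of length `≤ d`. -/
theorem positive_polynomial_sum_of_squares {m d : ℕ} (hd : 1 ≤ d)
    {C : Type*} [NormedAddCommGroup C] [InnerProductSpace ℂ C] [CompleteSpace C]
    (A : FreeGroup (Fin m) →₀ (C →L[ℂ] C))
    (hdeg : ∀ x : FreeGroup (Fin m), d < FreeGroup.norm x → A x = 0)
    (hpos : ∀ (X : BundledHilbertSpace)
      (U : Fin m → unitary (X.carrier →L[ℂ] X.carrier))
      (k : ℕ) (h : Fin k → C) (ξ : Fin k → X.carrier),
      0 ≤ ∑ i, ∑ j, ∑ x ∈ A.support,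
        (inner ℂ (h i) (A x (h j)) : ℂ) *
        (inner ℂ (ξ i)
          ((FreeGroup.lift U x : X.carrier →L[ℂ] X.carrier) (ξ j)) : ℂ)) :
    ∃ (N : ℕ) (B : Fin N → (FreeGroup (Fin m) →₀ (C →L[ℂ] C))),
      (∀ (j : Fin N) (s : FreeGroup (Fin m)), d < FreeGroup.norm s → B j s = 0) ∧
      ∀ x : FreeGroup (Fin m),
        (∑ j, ∑ s ∈ (B j).support, ∑ t ∈ (B j).support,
          if s⁻¹ * t = x then (ContinuousLinearMap.adjoint (B j s)).comp (B j t) else 0)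
        = if FreeGroup.norm x ≤ d then A x else 0 := by
  classical
  let S : Finset (FreeGroup (Fin m)) := (SOS.ball_finite m d).toFinset
  have hS : ∀ s, s ∈ S ↔ FreeGroup.norm s ≤ d := by intro s; simp [S]
  obtain ⟨β, h1, h2, h3, h4, h5, h6, h7⟩ := SOS.exists_form A hdeg hpos S hS
  obtain ⟨D, hD⟩ := SOS.exists_blocks β ‖A 1‖ (norm_nonneg _) h1 h2 h3 h4 h5 h6
  let e := Fintype.equivFin S
  let B : Fin (Fintype.card S) → (FreeGroup (Fin m) →₀ (C →L[ℂ] C)) := fun j =>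
    Finsupp.onFinset S (fun s => if hs : s ∈ S then D (e.symm j) ⟨s, hs⟩ else 0) (by
      intro s hs
      by_contra hc
      simp [hc] at hs)
  have hBs : ∀ j (s : S), B j s = D (e.symm j) s := by
    intro j s
    simp [B]
  have hsub : ∀ j, (B j).support ⊆ S := fun j => Finsupp.support_onFinset_subset
  refine ⟨Fintype.card S, B, ?_, ?_⟩
  · intro j s hs
    by_contra hc
    exact absurd ((hS s).1 (hsub j (Finsupp.mem_support_iff.2 hc))) (not_le.2 hs)
  · intro x
    have hr : (if FreeGroup.norm x ≤ d then A x else 0) = A x := by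
      split_ifs with hx
      · rfl
      · exact (hdeg x (not_le.1 hx)).symm
    rw [hr]
    have hl : ∀ j, (∑ s ∈ (B j).support, ∑ t ∈ (B j).support,
        if s⁻¹ * t = x then (ContinuousLinearMap.adjoint (B j s)).comp (B j t) else 0) =
        ∑ s : S, ∑ t : S, if (s : FreeGroup (Fin m))⁻¹ * (t : FreeGroup (Fin m)) = x then
          (ContinuousLinearMap.adjoint (D (e.symm j) s)).comp (D (e.symm j) t) else 0 := by
      intro j
      simp only [← hBs]
      rw [Finset.sum_coe_sort S (fun s => ∑ t : S,
        if s⁻¹ * (t : FreeGroup (Fin m)) = x then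
          (ContinuousLinearMap.adjoint (B j s)).comp (B j t) else 0)]
      refine Finset.sum_subset_zero_on_sdiff (hsub j) ?_ ?_
      · intro s hs
        have : B j s = 0 := Finsupp.notMem_support_iff.1 (Finset.mem_sdiff.1 hs).2
        refine Finset.sum_eq_zero fun t _ => ?_
        simp [this]
      · intro s _
        rw [Finset.sum_coe_sort S (fun t => if s⁻¹ * t = x then
          (ContinuousLinearMap.adjoint (B j s)).comp (B j t) else 0)]
        refine Finset.sum_subset_zero_on_sdiff (hsub j) ?_ (fun _ _ => rfl)
        intro t ht
        have : B j t = 0 := Finsupp.notMem_support_iff.1 (Finset.mem_sdiff.1 ht).2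
        simp [this]
    simp only [hl]
    rw [e.symm.sum_comp (fun j => ∑ s : S, ∑ t : S,
      if (s : FreeGroup (Fin m))⁻¹ * (t : FreeGroup (Fin m)) = x then
          (ContinuousLinearMap.adjoint (D j s)).comp (D j t) else 0)]
    ext1 h'
    refine ext_inner_left ℂ fun h => ?_
    rw [← h7 x h h']
    rw [Finset.sum_comm]
    simp only [ContinuousLinearMap.sum_apply, inner_sum]
    refine Finset.sum_congr rfl fun s _ => ?_
    rw [Finset.sum_comm]
    refine Finset.sum_congr rfl fun t _ => ?_
    split_ifs
    · rw [← hD]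
      refine Finset.sum_congr rfl fun j _ => ?_
      rw [ContinuousLinearMap.comp_apply, ContinuousLinearMap.adjoint_inner_right]
    · simp
end

section
/- Let I be a finite set, k ≠ l two elements of I, H a complex Hilbert space, and let A_{ij} ∈ L(H) be given for all pairs (i,j) ∈ I × I except (k,l) and (l,k), with A_{ji} = A_{ij}* for all specified pairs. Assume the two fully specified principal submatrices are positive semidefinite: Σ_{i,j ∈ I∖{l}} ⟨A_{ij}h_j, h_i⟩ ≥ 0 for all families (h_i)_{i ∈ I∖{l}} in H, and similarly with l replaced by k. Then there exists B ∈ L(H) such that, setting A_{kl} = B and A_{lk} = B*, the full matrix (A_{ij})_{i,j ∈ I} is positive semidefinite: Σ_{i,j ∈ I} ⟨A_{ij}h_j, h_i⟩ ≥ 0 for all families (h_i)_{i ∈ I} in H. -/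
open scoped ComplexOrder

lemma exists_gram {I : Type*} [Fintype I] [DecidableEq I]
    {H : Type*} [NormedAddCommGroup H] [InnerProductSpace ℂ H] [CompleteSpace H]
    (M : I → I → H →L[ℂ] H)
    (hM : ∀ h : I → H, 0 ≤ ∑ i, ∑ j, (inner ℂ (h i) (M i j (h j)) : ℂ)) :
    ∃ V : I → H →L[ℂ] PiLp 2 (fun _ : I => H), ∀ i j x y,
      inner ℂ (V i x) (V j y) = inner ℂ x (M i j y) := by
  let ι : I → H →L[ℂ] PiLp 2 (fun _ : I => H) := fun i =>
    ((PiLp.continuousLinearEquiv 2 ℂ (fun _ : I => H)).symm :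
      (I → H) →L[ℂ] PiLp 2 (fun _ : I => H)) ∘L ContinuousLinearMap.single ℂ (fun _ : I => H) i
  let T : PiLp 2 (fun _ : I => H) →L[ℂ] PiLp 2 (fun _ : I => H) :=
    ∑ i, ∑ j, ι i ∘L M i j ∘L PiLp.proj 2 (fun _ : I => H) j
  have hι : ∀ i x j, (ι i x) j = if j = i then x else 0 := by
    intro i x j
    simp [ι, Pi.single_apply]
  have hin : ∀ i x z, inner ℂ z (ι i x) = (inner ℂ (z i) x : ℂ) := by
    intro i x z
    rw [PiLp.inner_apply]
    simp only [hι]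
    rw [Finset.sum_eq_single i] <;> simp +contextual
  have hT : ∀ z w, inner ℂ z (T w) = ∑ i, ∑ j, (inner ℂ (z i) (M i j (w j)) : ℂ) := by
    intro z w
    simp [T, inner_sum, hin]
  have hpos : 0 ≤ T := by
    rw [ContinuousLinearMap.nonneg_iff_isPositive, ContinuousLinearMap.isPositive_iff_complex]
    intro x
    have h := hM x
    rw [← hT] at h
    have hz : inner ℂ (T x) x = (inner ℂ x (T x) : ℂ) := by
      rw [← inner_conj_symm]
      exact RCLike.conj_eq_iff_im.2 (Complex.le_def.1 h).2.symm
    rw [hz]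
    obtain ⟨h1, h2⟩ := Complex.le_def.1 h
    refine ⟨Complex.ext ?_ ?_, by simpa using h1⟩
    · simp
    · simpa using h2
  have hsa : IsSelfAdjoint (CFC.sqrt T) := IsSelfAdjoint.of_nonneg (CFC.sqrt_nonneg T)
  have hss : CFC.sqrt T * CFC.sqrt T = T := CFC.sqrt_mul_sqrt_self T hpos
  refine ⟨fun i => CFC.sqrt T ∘L ι i, fun i j x y => ?_⟩
  have h1 : inner ℂ (CFC.sqrt T (ι i x)) (CFC.sqrt T (ι j y)) = inner ℂ (ι i x) (T (ι j y)) := by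
    rw [← ContinuousLinearMap.adjoint_inner_right, ← ContinuousLinearMap.star_eq_adjoint, hsa.star_eq]
    conv_rhs => rw [← hss]
    rfl
  simp only [ContinuousLinearMap.comp_apply]
  rw [h1, hT]
  simp only [hι]
  rw [Finset.sum_eq_single i, Finset.sum_eq_single j] <;> simp +contextual

lemma exists_contraction {E F G : Type*} [AddCommGroup E] [Module ℂ E]
    [NormedAddCommGroup F] [InnerProductSpace ℂ F] [CompleteSpace F]
    [NormedAddCommGroup G] [InnerProductSpace ℂ G] [CompleteSpace G]
    (f : E →ₗ[ℂ] F) (g : E →ₗ[ℂ] G) (h : ∀ x, ‖g x‖ = ‖f x‖) :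
    ∃ D : G →L[ℂ] F, (∀ b, ‖D b‖ ≤ ‖b‖) ∧ ∀ x b, inner ℂ (f x) (D b) = (inner ℂ (g x) b : ℂ) := by
  let N := (LinearMap.range f).topologicalClosure
  have : CompleteSpace N := (LinearMap.range f).isClosed_topologicalClosure.completeSpace_coe
  let e : E →ₗ[ℂ] N := f.codRestrict N
    (fun x => (LinearMap.range f).le_topologicalClosure (LinearMap.mem_range_self f x))
  have hd : DenseRange e := by
    intro y
    rw [Metric.mem_closure_iff]
    intro ε hε
    have hy : (y : F) ∈ closure (Set.range f) := y.2
    obtain ⟨_, ⟨x, rfl⟩, hx⟩ := Metric.mem_closure_iff.1 hy ε hε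
    exact ⟨e x, ⟨x, rfl⟩, hx⟩
  have hb : ∀ x, ‖g x‖ ≤ (1:ℝ) * ‖e x‖ := fun x => by
    rw [one_mul, h x]; exact le_rfl
  let U : N →L[ℂ] G := g.extendOfNorm e
  have hU : ∀ x, U (e x) = g x := fun x => LinearMap.extendOfNorm_eq hd ⟨1, hb⟩ x
  have hUn : ‖U‖ ≤ 1 := LinearMap.opNorm_extendOfNorm_le hd zero_le_one hb
  let D' : F →L[ℂ] G := U ∘L N.orthogonalProjectionOnto
  have hD' : ‖D'‖ ≤ 1 := by
    refine (ContinuousLinearMap.opNorm_comp_le _ _).trans ?_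
    exact mul_le_one₀ hUn (norm_nonneg _) (N.orthogonalProjectionOnto_norm_le)
  refine ⟨ContinuousLinearMap.adjoint D', fun b => ?_, fun x b => ?_⟩
  · refine (ContinuousLinearMap.le_opNorm _ _).trans ?_
    rw [LinearIsometryEquiv.norm_map]
    exact mul_le_of_le_one_left (norm_nonneg _) hD'
  · rw [ContinuousLinearMap.adjoint_inner_right]
    congr 1
    rw [← hU x]
    have := N.orthogonalProjectionOnto_mem_subspace_eq_self (e x)
    exact congrArg U this

/-- A partially positive Hermitian block operator matrix over a finite
index set `I`, whose only unspecified entries are at positions `(k,l)` and `(l,k)`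
(`k ≠ l`), admits a positive semidefinite completion: there is `B ∈ L(H)` such that
putting `B` at `(k,l)` and `B⋆` at `(l,k)` makes the whole matrix positive
semidefinite. -/
theorem one_entry_positive_completion {I : Type*} [Fintype I] [DecidableEq I]
    (k l : I) (hkl : k ≠ l)
    {H : Type*} [NormedAddCommGroup H] [InnerProductSpace ℂ H] [CompleteSpace H]
    (A : I → I → H →L[ℂ] H)
    (hherm : ∀ i j : I, ¬((i = k ∧ j = l) ∨ (i = l ∧ j = k)) →
      A j i = ContinuousLinearMap.adjoint (A i j))
    (hposl : ∀ h : I → H,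
      0 ≤ ∑ i ∈ Finset.univ.erase l, ∑ j ∈ Finset.univ.erase l,
        (inner ℂ (h i) (A i j (h j)) : ℂ))
    (hposk : ∀ h : I → H,
      0 ≤ ∑ i ∈ Finset.univ.erase k, ∑ j ∈ Finset.univ.erase k,
        (inner ℂ (h i) (A i j (h j)) : ℂ)) :
    ∃ B : H →L[ℂ] H, ∀ h : I → H,
      0 ≤ ∑ i, ∑ j,
        (inner ℂ (h i)
          ((if i = k ∧ j = l then B
            else if i = l ∧ j = k then ContinuousLinearMap.adjoint B
            else A i j) (h j)) : ℂ) := by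
  obtain ⟨V, hV⟩ := exists_gram (fun i j => if i = l ∨ j = l then 0 else A i j) (by
    intro h
    refine (hposl h).trans_eq ?_
    rw [← Finset.sum_erase (a := l) Finset.univ (by simp)]
    refine Finset.sum_congr rfl fun i hi => ?_
    rw [← Finset.sum_erase (a := l) Finset.univ (by simp)]
    refine Finset.sum_congr rfl fun j hj => ?_
    rw [if_neg (by simpa using ⟨Finset.ne_of_mem_erase hi, Finset.ne_of_mem_erase hj⟩)])
  obtain ⟨W, hW⟩ := exists_gram (fun i j => if i = k ∨ j = k then 0 else A i j) (by
    intro h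
    refine (hposk h).trans_eq ?_
    rw [← Finset.sum_erase (a := k) Finset.univ (by simp)]
    refine Finset.sum_congr rfl fun i hi => ?_
    rw [← Finset.sum_erase (a := k) Finset.univ (by simp)]
    refine Finset.sum_congr rfl fun j hj => ?_
    rw [if_neg (by simpa using ⟨Finset.ne_of_mem_erase hi, Finset.ne_of_mem_erase hj⟩)])
  have hV' : ∀ i j x y, i ≠ l → j ≠ l → inner ℂ x (A i j y) = (inner ℂ (V i x) (V j y) : ℂ) := by
    intro i j x y hi hj
    rw [hV, if_neg (by tauto)]
  have hW' : ∀ i j x y, i ≠ k → j ≠ k → inner ℂ x (A i j y) = (inner ℂ (W i x) (W j y) : ℂ) := by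
    intro i j x y hi hj
    rw [hW, if_neg (by tauto)]
  let s : Finset I := (Finset.univ.erase k).erase l
  have hsk : ∀ i ∈ s, i ≠ k := fun i hi => Finset.ne_of_mem_erase (Finset.mem_of_mem_erase hi)
  have hsl : ∀ i ∈ s, i ≠ l := fun i hi => Finset.ne_of_mem_erase hi
  have hlk := hkl.symm
  let f : (I → H) →ₗ[ℂ] PiLp 2 (fun _ : I => H) :=
    ∑ i ∈ s, (V i : H →ₗ[ℂ] PiLp 2 (fun _ : I => H)) ∘ₗ LinearMap.proj i
  let g : (I → H) →ₗ[ℂ] PiLp 2 (fun _ : I => H) :=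
    ∑ i ∈ s, (W i : H →ₗ[ℂ] PiLp 2 (fun _ : I => H)) ∘ₗ LinearMap.proj i
  have hf : ∀ x, f x = ∑ i ∈ s, V i (x i) := fun x => by simp [f]
  have hg : ∀ x, g x = ∑ i ∈ s, W i (x i) := fun x => by simp [g]
  have hff : ∀ x, inner ℂ (f x) (f x) = ∑ i ∈ s, ∑ j ∈ s, (inner ℂ (x i) (A i j (x j)) : ℂ) := by
    intro x
    rw [hf, sum_inner]
    refine Finset.sum_congr rfl fun i hi => ?_
    rw [inner_sum]
    exact Finset.sum_congr rfl fun j hj => (hV' _ _ _ _ (hsl i hi) (hsl j hj)).symm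
  have hgg : ∀ x, inner ℂ (g x) (g x) = ∑ i ∈ s, ∑ j ∈ s, (inner ℂ (x i) (A i j (x j)) : ℂ) := by
    intro x
    rw [hg, sum_inner]
    refine Finset.sum_congr rfl fun i hi => ?_
    rw [inner_sum]
    exact Finset.sum_congr rfl fun j hj => (hW' _ _ _ _ (hsk i hi) (hsk j hj)).symm
  obtain ⟨D, hD, hDi⟩ := exists_contraction f g (fun x => by
    rw [@norm_eq_sqrt_re_inner ℂ, @norm_eq_sqrt_re_inner ℂ _ _ _ _ (f x), hff, hgg])
  refine ⟨ContinuousLinearMap.adjoint (V k) ∘L D ∘L W l, fun h => ?_⟩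
  have hsum : ∀ F : I → ℂ, ∑ i, F i = F k + (F l + ∑ i ∈ s, F i) := by
    intro F
    rw [Finset.add_sum_erase _ _ (by simp [hlk]), Finset.add_sum_erase _ _ (by simp)]
  have e1 : ∑ j ∈ s, (inner ℂ (h k) (A k j (h j)) : ℂ) = inner ℂ (V k (h k)) (f h) := by
    rw [hf, inner_sum]
    exact Finset.sum_congr rfl fun j hj => hV' _ _ _ _ hkl (hsl j hj)
  have e2 : ∑ j ∈ s, (inner ℂ (h j) (A j k (h k)) : ℂ) = inner ℂ (f h) (V k (h k)) := by
    rw [hf, sum_inner]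
    exact Finset.sum_congr rfl fun j hj => hV' _ _ _ _ (hsl j hj) hkl
  have e3 : ∑ j ∈ s, (inner ℂ (h l) (A l j (h j)) : ℂ) = inner ℂ (D (W l (h l))) (f h) := by
    rw [← inner_conj_symm, hDi, inner_conj_symm, hg, inner_sum]
    exact Finset.sum_congr rfl fun j hj => hW' _ _ _ _ hlk (hsk j hj)
  have e4 : ∑ j ∈ s, (inner ℂ (h j) (A j l (h l)) : ℂ) = inner ℂ (f h) (D (W l (h l))) := by
    rw [hDi, hg, sum_inner]
    exact Finset.sum_congr rfl fun j hj => hW' _ _ _ _ (hsk j hj) hlk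
  have key : ∑ i, ∑ j,
        (inner ℂ (h i)
          ((if i = k ∧ j = l then ContinuousLinearMap.adjoint (V k) ∘L D ∘L W l
            else if i = l ∧ j = k then
              ContinuousLinearMap.adjoint (ContinuousLinearMap.adjoint (V k) ∘L D ∘L W l)
            else A i j) (h j)) : ℂ) =
      inner ℂ (V k (h k) + f h + D (W l (h l))) (V k (h k) + f h + D (W l (h l))) +
      (inner ℂ (W l (h l)) (W l (h l)) - inner ℂ (D (W l (h l))) (D (W l (h l)))) := by
    rw [hsum]
    simp only [hsum]
    rw [Finset.sum_add_distrib, Finset.sum_add_distrib]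
    simp only [hkl, hlk, and_true, true_and, and_false, false_and, if_true, if_false,
      ContinuousLinearMap.adjoint_comp, ContinuousLinearMap.adjoint_adjoint]
    rw [Finset.sum_congr (s₁ := s) rfl (fun j hj => by rw [if_neg (hsl j hj)]), e1,
      Finset.sum_congr (s₁ := s) rfl (fun j hj => by rw [if_neg (hsk j hj)]), e3,
      Finset.sum_congr (s₁ := s) rfl (fun j hj => by rw [if_neg (hsl j hj)]), e2,
      Finset.sum_congr (s₁ := s) rfl (fun j hj => by rw [if_neg (hsk j hj)]), e4]
    have e5 : ∑ i ∈ s, ∑ j ∈ s, (inner ℂ (h i)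
          ((if i = k ∧ j = l then ContinuousLinearMap.adjoint (V k) ∘L D ∘L W l
            else if i = l ∧ j = k then
              (ContinuousLinearMap.adjoint (W l) ∘L ContinuousLinearMap.adjoint D) ∘L V k
            else A i j) (h j)) : ℂ) = inner ℂ (f h) (f h) := by
      rw [hff]
      refine Finset.sum_congr rfl fun i hi => Finset.sum_congr rfl fun j hj => ?_
      rw [if_neg (fun c => hsk i hi c.1), if_neg (fun c => hsl i hi c.1)]
    rw [e5]
    simp only [ContinuousLinearMap.comp_apply, ContinuousLinearMap.adjoint_inner_right,
      hV' k k _ _ hkl hkl, hW' l l _ _ hlk hlk, inner_add_left, inner_add_right]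
    ring
  rw [key]
  apply add_nonneg
  · rw [inner_self_eq_norm_sq_to_K]
    have := Complex.zero_le_real.2 (sq_nonneg ‖V k (h k) + f h + D (W l (h l))‖)
    simpa using this
  · rw [inner_self_eq_norm_sq_to_K, inner_self_eq_norm_sq_to_K, sub_nonneg]
    have := pow_le_pow_left₀ (norm_nonneg _) (hD (W l (h l))) 2
    exact_mod_cast this
end
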